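/- arXiv:1409.7983 — 3 statements merged into one kernel-verified Lean document; each statement's English description precedes it below -/
import Mathlib

section
/- Let G be a graph with at least one edge and let δ = emin(G), where emin(G) is the minimum, over all edges uv of G, of max(deg_G(u), deg_G(v)). Then for every n ≥ δ, every (Q_n, G)-saturated subgraph H of the hypercube Q_n satisfies e(H) ≥ (δ−1)·n·2^(n−1)/(2n−δ+1). In particular sat(Q_n, G) ≥ (δ−1)·n·2^(n−1)/(2n−δ+1) = (δ−1+o(1))·2^(n−2). -/
open SimpleGraph

/-- The hypercube graph `Q_n` on vertex set `{0,1}^n`: two vertices are adjacent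
iff they differ in exactly one coordinate. -/
def hypercube (n : ℕ) : SimpleGraph (Fin n → Bool) :=
  SimpleGraph.fromRel (fun u v => hammingDist u v = 1)

/-- `HasCopy H G` means `H` contains a subgraph isomorphic to `G`. -/
def HasCopy {V W : Type*} (H : SimpleGraph V) (G : SimpleGraph W) : Prop :=
  ∃ f : G →g H, Function.Injective f

/-- `IsSat Host H G`: `H` is an `(Host, G)`-saturated subgraph of `Host`. -/
def IsSat {V W : Type*} (Host H : SimpleGraph V) (G : SimpleGraph W) : Prop :=
  H ≤ Host ∧ ¬ HasCopy H G ∧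
    ∀ u v : V, Host.Adj u v → ¬ H.Adj u v →
      HasCopy (H ⊔ SimpleGraph.fromEdgeSet {s(u, v)}) G

/-- The saturation number `sat(Host, G)`. -/
noncomputable def satNum {V W : Type*} (Host : SimpleGraph V) (G : SimpleGraph W) : ℕ :=
  sInf { m | ∃ H : SimpleGraph V, IsSat Host H G ∧ H.edgeSet.ncard = m }

theorem hypercube_adj_iff {n : ℕ} (u v : Fin n → Bool) :
    (hypercube n).Adj u v ↔ ∃ i, v = Function.update u i (!u i) := by
  simp only [hypercube, SimpleGraph.fromRel_adj, hammingDist_comm v u, or_self]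
  constructor
  · rintro ⟨-, h⟩
    rw [hammingDist, Finset.card_eq_one] at h
    obtain ⟨i, hi⟩ := h
    refine ⟨i, funext fun j => ?_⟩
    have hj := Finset.ext_iff.mp hi j
    simp only [Finset.mem_filter, Finset.mem_univ, true_and, Finset.mem_singleton] at hj
    by_cases hij : j = i
    · subst hij
      have hne : u j ≠ v j := hj.mpr rfl
      simpa using (Bool.eq_not.mpr hne.symm)
    · rw [Function.update_of_ne hij]
      by_contra hne
      exact hij (hj.mp (Ne.symm hne))
  · rintro ⟨i, rfl⟩
    refine ⟨fun h => by simpa using congrFun h i, ?_⟩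
    rw [hammingDist, Finset.card_eq_one]
    refine ⟨i, Finset.ext fun j => ?_⟩
    by_cases hij : j = i
    · subst hij; simp
    · simp [hij]

theorem hypercube_ncard_neighborSet {n : ℕ} (u : Fin n → Bool) :
    ((hypercube n).neighborSet u).ncard = n := by
  have h : (hypercube n).neighborSet u =
      Set.range fun i => Function.update u i (!u i) := by
    ext v
    simp [hypercube_adj_iff, eq_comm]
  have hinj : Function.Injective fun i => Function.update u i (!u i) := by
    intro i j hij
    by_contra hne
    have := congrFun hij i
    simp [Function.update_of_ne hne] at this
  rw [h, ← Set.image_univ, Set.ncard_image_of_injective _ hinj, Set.ncard_univ, Nat.card_fin]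

/-- The endpoint condition forced on a missing edge `uv` by saturation. -/
theorem IsSat.le_max_ncard_neighborSet_add_one {V W : Type*} [Finite V] {Host H : SimpleGraph V}
    {G : SimpleGraph W} (hH : IsSat Host H G) {u v : V} (huv : Host.Adj u v)
    (hn : ¬ H.Adj u v) :
    sInf { d | ∃ x y : W, G.Adj x y ∧
        d = max (G.neighborSet x).ncard (G.neighborSet y).ncard } ≤
      max (H.neighborSet u).ncard (H.neighborSet v).ncard + 1 := by
  obtain ⟨-, hfree, hsat⟩ := hH
  obtain ⟨f, hf⟩ := hsat u v huv hn
  have hdeg : ∀ (x : W) (a b : V), f x = a → s(a, b) = s(u, v) →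
      (G.neighborSet x).ncard ≤ (H.neighborSet a).ncard + 1 := by
    intro x a b hx hab
    rw [← Set.ncard_image_of_injective _ hf]
    refine (Set.ncard_le_ncard (t := insert b (H.neighborSet a)) ?_ (Set.toFinite _)).trans
      (Set.ncard_insert_le _ _)
    rintro _ ⟨z, hz, rfl⟩
    have hadj := f.map_adj hz
    rw [hx, SimpleGraph.sup_adj, SimpleGraph.fromEdgeSet_adj, Set.mem_singleton_iff] at hadj
    rcases hadj with h | ⟨h, -⟩
    · exact Or.inr h
    · exact Or.inl (Sym2.congr_right.mp (h.trans hab.symm))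
  obtain ⟨x, y, hxy, he⟩ : ∃ x y, G.Adj x y ∧ s(f x, f y) = s(u, v) := by
    by_contra! hcon
    refine hfree ⟨⟨f, fun {x y} hxy => ?_⟩, hf⟩
    have hadj := f.map_adj hxy
    rw [SimpleGraph.sup_adj, SimpleGraph.fromEdgeSet_adj] at hadj
    exact hadj.resolve_right fun h => hcon x y hxy h.1
  have hle : sInf { d | ∃ x y : W, G.Adj x y ∧
      d = max (G.neighborSet x).ncard (G.neighborSet y).ncard } ≤
      max (G.neighborSet x).ncard (G.neighborSet y).ncard := Nat.sInf_le ⟨x, y, hxy, rfl⟩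
  refine hle.trans ?_
  have hx := hdeg x (f x) (f y) rfl he
  have hy := hdeg y (f y) (f x) rfl (Sym2.eq_swap.trans he)
  rcases Sym2.eq_iff.mp he with ⟨h1, h2⟩ | ⟨h1, h2⟩ <;> rw [h1] at hx <;> rw [h2] at hy <;> omega

theorem IsSat.exists_of_edgeSet_nonempty {V W : Type*} [Finite V] (Host : SimpleGraph V)
    {G : SimpleGraph W} (hG : G.edgeSet.Nonempty) : ∃ H, IsSat Host H G := by
  have hbot : ¬ HasCopy (⊥ : SimpleGraph V) G := by
    rintro ⟨f, -⟩
    obtain ⟨e, he⟩ := hG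
    induction e using Sym2.ind with
    | _ x y => exact f.map_adj he
  obtain ⟨H, hH⟩ := (Set.toFinite {H : SimpleGraph V | H ≤ Host ∧ ¬ HasCopy H G}).exists_maximal
    ⟨⊥, bot_le, hbot⟩
  refine ⟨H, hH.prop.1, hH.prop.2, fun u v huv hn => ?_⟩
  by_contra hc
  have hle : H ⊔ SimpleGraph.fromEdgeSet {s(u, v)} ≤ Host := by
    refine sup_le hH.prop.1 fun a b hab => ?_
    rw [SimpleGraph.fromEdgeSet_adj, Set.mem_singleton_iff] at hab
    rcases Sym2.eq_iff.mp hab.1 with ⟨rfl, rfl⟩ | ⟨rfl, rfl⟩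
    exacts [huv, huv.symm]
  refine hn (hH.le_of_ge ⟨hle, hc⟩ le_sup_left ?_)
  simp [huv.ne]

/-- A subgraph `H` of an `n`-regular graph such that every missing edge has an endpoint of
`H`-degree at least `d` has many edges. -/
theorem mul_card_le_mul_ncard_edgeSet {V : Type*} [Fintype V] {Q H : SimpleGraph V} {n d : ℕ}
    (hQ : ∀ v, (Q.neighborSet v).ncard = n) (hHQ : H ≤ Q) (hd : d ≤ n)
    (hmiss : ∀ u v, Q.Adj u v → ¬ H.Adj u v →
      d ≤ (H.neighborSet u).ncard ∨ d ≤ (H.neighborSet v).ncard) :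
    (d : ℝ) * n * Fintype.card V ≤ (2 * n - d) * (2 * H.edgeSet.ncard) := by
  classical
  have hdegH : ∀ v, (H.neighborSet v).ncard = H.degree v := fun v => by
    rw [Set.ncard_eq_toFinset_card', ← SimpleGraph.card_neighborFinset_eq_degree]; rfl
  simp only [hdegH] at hmiss
  set K : V → V → Prop := fun u v => Q.Adj u v ∧ ¬ H.Adj u v with hK
  have hsplit : ∀ v, H.degree v + (Finset.univ.filter (K v)).card = n := fun v => by
    rw [← hQ v, Set.ncard_eq_toFinset_card', ← SimpleGraph.card_neighborFinset_eq_degree,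
      ← Finset.card_union_of_disjoint]
    · congr 1
      ext w
      simp only [Finset.mem_union, SimpleGraph.mem_neighborFinset, Finset.mem_filter,
        Finset.mem_univ, true_and, Set.mem_toFinset, SimpleGraph.mem_neighborSet, hK]
      have := @hHQ v w
      tauto
    · rw [Finset.disjoint_left]
      intro w hw hw'
      exact (Finset.mem_filter.mp hw').2.2 (by simpa using hw)
  set A : Finset V := Finset.univ.filter fun v => d ≤ H.degree v with hA
  have hKle : ∑ v ∈ Aᶜ, (Finset.univ.filter (K v)).card ≤
      ∑ v ∈ A, (Finset.univ.filter (K v)).card := by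
    calc ∑ v ∈ Aᶜ, (Finset.univ.filter (K v)).card
        ≤ ∑ v ∈ Aᶜ, (A.bipartiteAbove K v).card := by
          refine Finset.sum_le_sum fun v hv => Finset.card_le_card fun w hw => ?_
          have hvw : K v w := (Finset.mem_filter.mp hw).2
          have hv' : ¬ d ≤ H.degree v := by simpa [hA] using hv
          rw [Finset.mem_bipartiteAbove]
          exact ⟨by simpa [hA] using (hmiss v w hvw.1 hvw.2).resolve_left hv', hvw⟩
      _ = ∑ w ∈ A, (Aᶜ.bipartiteBelow K w).card :=
          Finset.sum_card_bipartiteAbove_eq_sum_card_bipartiteBelow K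
      _ ≤ ∑ w ∈ A, (Finset.univ.filter (K w)).card := by
          refine Finset.sum_le_sum fun w _ => Finset.card_le_card fun v hv => ?_
          have hvw : K v w := (Finset.mem_bipartiteBelow K |>.mp hv).2
          exact Finset.mem_filter.mpr
            ⟨Finset.mem_univ _, hvw.1.symm, fun h => hvw.2 h.symm⟩
  have hsumA : ∑ v ∈ A, H.degree v + ∑ v ∈ A, (Finset.univ.filter (K v)).card = A.card * n := by
    rw [← Finset.sum_add_distrib, Finset.sum_congr rfl fun v _ => hsplit v, Finset.sum_const,
      smul_eq_mul]
  have hsumB : ∑ v ∈ Aᶜ, H.degree v + ∑ v ∈ Aᶜ, (Finset.univ.filter (K v)).card =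
      Aᶜ.card * n := by
    rw [← Finset.sum_add_distrib, Finset.sum_congr rfl fun v _ => hsplit v, Finset.sum_const,
      smul_eq_mul]
  have hdA : A.card * d ≤ ∑ v ∈ A, H.degree v := by
    rw [← smul_eq_mul]
    exact Finset.card_nsmul_le_sum _ _ _ fun v hv => (Finset.mem_filter.mp hv).2
  have htot : ∑ v ∈ A, H.degree v + ∑ v ∈ Aᶜ, H.degree v = 2 * H.edgeSet.ncard := by
    rw [Finset.sum_add_sum_compl, SimpleGraph.sum_degrees_eq_twice_card_edges,
      Set.ncard_eq_toFinset_card']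
    rfl
  have hcard := A.card_add_card_compl
  generalize ∑ v ∈ A, H.degree v = DA at *
  generalize ∑ v ∈ Aᶜ, H.degree v = DB at *
  generalize ∑ v ∈ A, (Finset.univ.filter (K v)).card = KA at *
  generalize ∑ v ∈ Aᶜ, (Finset.univ.filter (K v)).card = KB at *
  generalize A.card = a at *
  generalize Aᶜ.card = b at *
  generalize H.edgeSet.ncard = e at *
  rw [← hcard]
  push_cast
  rify at *
  have h1 : (0 : ℝ) ≤ n - d := by linarith
  have h2 : (a : ℝ) * d ≤ 2 * e := by linarith [(Nat.cast_nonneg DB : (0 : ℝ) ≤ DB)]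
  have h3 : 2 * (a * d) + (b - a) * n ≤ 2 * (e : ℝ) := by linarith
  nlinarith [mul_le_mul_of_nonneg_left h2 h1,
    mul_le_mul_of_nonneg_left h3 (Nat.cast_nonneg d : (0 : ℝ) ≤ d)]


/-- lower bound on the saturation number in terms of
`emin(G) = δ`, the minimum over edges `uv` of `max(deg u, deg v)`. -/
theorem stmt0 {V : Type*} [Fintype V] (G : SimpleGraph V) (δ : ℕ)
    (hne : G.edgeSet.Nonempty)
    (hδ : δ = sInf { d | ∃ u v : V, G.Adj u v ∧
        d = max (G.neighborSet u).ncard (G.neighborSet v).ncard })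
    (n : ℕ) (hn : δ ≤ n) :
    (∀ H : SimpleGraph (Fin n → Bool), IsSat (hypercube n) H G →
        ((δ : ℝ) - 1) * n * 2 ^ (n - 1) / (2 * n - δ + 1) ≤ (H.edgeSet.ncard : ℝ)) ∧
      ((δ : ℝ) - 1) * n * 2 ^ (n - 1) / (2 * n - δ + 1) ≤ (satNum (hypercube n) G : ℝ) := by
  have hlow : ∀ H : SimpleGraph (Fin n → Bool), IsSat (hypercube n) H G →
      ((δ : ℝ) - 1) * n * 2 ^ (n - 1) / (2 * n - δ + 1) ≤ (H.edgeSet.ncard : ℝ) := by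
    intro H hH
    have hδ1 : 1 ≤ δ := by
      obtain ⟨e, he⟩ := hne
      induction e using Sym2.ind with
      | _ x y =>
        obtain ⟨u, v, huv, h⟩ := Nat.sInf_mem (s := { d | ∃ u v : V, G.Adj u v ∧
          d = max (G.neighborSet u).ncard (G.neighborSet v).ncard }) ⟨_, x, y, he, rfl⟩
        rw [hδ, h]
        exact le_max_of_le_left ((Set.ncard_pos (Set.toFinite _)).mpr ⟨v, huv⟩)
    have key := mul_card_le_mul_ncard_edgeSet (d := δ - 1) hypercube_ncard_neighborSet hH.1
      (n := n) (by omega) fun u v huv hn => by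
        have := hH.le_max_ncard_neighborSet_add_one huv hn
        rw [← hδ] at this
        omega
    obtain ⟨m, rfl⟩ : ∃ m, n = m + 1 := ⟨n - 1, by omega⟩
    have hle : (δ : ℝ) ≤ (m + 1 : ℕ) := by exact_mod_cast hn
    rw [Nat.cast_sub hδ1] at key
    simp only [Fintype.card_fun, Fintype.card_bool, Fintype.card_fin] at key
    rw [div_le_iff₀ (by push_cast at hle ⊢; linarith [(Nat.cast_nonneg m : (0 : ℝ) ≤ m)])]
    push_cast [pow_succ] at key ⊢
    linarith
  refine ⟨hlow, ?_⟩
  obtain ⟨H₀, hH₀⟩ := IsSat.exists_of_edgeSet_nonempty (hypercube n) hne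
  obtain ⟨H, hH, hcard⟩ := Nat.sInf_mem (s := { m | ∃ H : SimpleGraph (Fin n → Bool),
    IsSat (hypercube n) H G ∧ H.edgeSet.ncard = m }) ⟨_, H₀, hH₀, rfl⟩
  rw [satNum, ← hcard]
  exact hlow H hH
end

section
/- Let k > 4 be an integer and let i = ⌊log_2(k−1)⌋. Then for all sufficiently large n: if k is odd, sat(Q_n, P_k) ≤ (i+1)·(k−1)/2^(i+1) · 2^(n−1); and if k is even, sat(Q_n, P_k) ≤ (i·(k−2)/2^(i+1) + 1) · 2^(n−1). -/
open SimpleGraph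

/-- Flip the `j`-th coordinate of a vertex of the hypercube. -/
def flipAt {n : ℕ} (x : Fin n → Bool) (j : Fin n) : Fin n → Bool :=
  Function.update x j (!x j)

lemma flipAt_same {n : ℕ} (x : Fin n → Bool) (j : Fin n) : flipAt x j j = !x j := by
  simp [flipAt]

lemma flipAt_ne {n : ℕ} (x : Fin n → Bool) {i j : Fin n} (h : i ≠ j) : flipAt x j i = x i := by
  simp [flipAt, h]

lemma flipAt_flipAt {n : ℕ} (x : Fin n → Bool) (j : Fin n) : flipAt (flipAt x j) j = x := by
  simp [flipAt]

lemma flipAt_injective {n : ℕ} (j : Fin n) :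
    Function.Injective (fun x : Fin n → Bool => flipAt x j) :=
  Function.LeftInverse.injective (g := fun x => flipAt x j) fun x => flipAt_flipAt x j

lemma flipAt_comm {n : ℕ} (x : Fin n → Bool) (i j : Fin n) :
    flipAt (flipAt x i) j = flipAt (flipAt x j) i := by
  funext t
  by_cases h : i = j
  · rw [h]
  · by_cases hi : t = i <;> by_cases hj : t = j <;> simp_all [flipAt, Function.update_apply]

lemma hypercube_adj {n : ℕ} {u v : Fin n → Bool} :
    (hypercube n).Adj u v ↔ ∃ j, v = flipAt u j := by
  have key : hammingDist u v = 1 ↔ ∃ j, v = flipAt u j := by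
    rw [hammingDist, Finset.card_eq_one]
    refine exists_congr fun j => ⟨fun h => ?_, ?_⟩
    · funext t
      have ht := Finset.ext_iff.1 h t
      simp only [Finset.mem_filter, Finset.mem_univ, true_and, Finset.mem_singleton] at ht
      by_cases e : t = j
      · subst e
        rw [flipAt_same]
        have := ht.2 rfl
        revert this
        cases u t <;> cases v t <;> simp
      · rw [flipAt_ne _ e]
        by_contra hne
        exact e (ht.1 (Ne.symm hne))
    · rintro rfl
      ext t
      simp only [Finset.mem_filter, Finset.mem_univ, true_and, Finset.mem_singleton]
      by_cases e : t = j
      · subst e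
        simp [flipAt_same]
      · simp [flipAt_ne _ e, e]
  rw [hypercube, SimpleGraph.fromRel_adj, hammingDist_comm v u, or_self, key, and_iff_right_iff_imp]
  rintro ⟨j, rfl⟩ h
  have := congrFun h j
  simp [flipAt_same] at this

/-- The number of coordinates equal to `1`. -/
def weight {n : ℕ} (x : Fin n → Bool) : ℕ := ∑ j, (x j).toNat

lemma weight_flipAt {n : ℕ} (x : Fin n → Bool) (j : Fin n) :
    (weight (flipAt x j) + weight x) % 2 = 1 := by
  have h : ∑ t ∈ Finset.univ.erase j, (flipAt x j t).toNat =
      ∑ t ∈ Finset.univ.erase j, (x t).toNat :=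
    Finset.sum_congr rfl fun t ht => by rw [flipAt_ne _ (Finset.ne_of_mem_erase ht)]
  rw [weight, weight, ← Finset.add_sum_erase _ _ (Finset.mem_univ j),
    ← Finset.add_sum_erase _ (fun t => (x t).toNat) (Finset.mem_univ j), h, flipAt_same]
  cases x j <;> simp <;> omega

lemma weight_of_adj {n : ℕ} {u v : Fin n → Bool} (h : (hypercube n).Adj u v) :
    (weight u + weight v) % 2 = 1 := by
  obtain ⟨j, rfl⟩ := hypercube_adj.1 h
  have := weight_flipAt u j
  omega

/-- Every subcube spanned by the first `D` coordinates has a Hamiltonian path from any vertex,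
closing up to a cycle when `D > 0`. -/
lemma exists_gray {n : ℕ} (D : ℕ) (hD : D ≤ n) (v : Fin n → Bool) :
    ∃ h : ℕ → Fin n → Bool, h 0 = v ∧
      (∀ i, i + 1 < 2 ^ D → (hypercube n).Adj (h i) (h (i + 1))) ∧
      (∀ i j, i < 2 ^ D → j < 2 ^ D → h i = h j → i = j) ∧
      (∀ x, (∃ i < 2 ^ D, h i = x) ↔ ∀ j : Fin n, D ≤ j → x j = v j) ∧
      (0 < D → (hypercube n).Adj (h (2 ^ D - 1)) (h 0)) := by
  induction D with
  | zero =>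
    refine ⟨fun _ => v, rfl, by simp, by simp, fun x => ?_, by simp⟩
    constructor
    · rintro ⟨i, -, rfl⟩ j -
      rfl
    · intro h
      exact ⟨0, by simp, funext fun j => (h j (Nat.zero_le _)).symm⟩
  | succ D ih =>
    obtain ⟨h, h0, hadj, hinj, hran, -⟩ := ih (by omega)
    set d : Fin n := ⟨D, by omega⟩ with hd
    have hpos : 0 < 2 ^ D := by positivity
    have hpow : 2 ^ (D + 1) = 2 * 2 ^ D := by ring
    have hhd : ∀ i < 2 ^ D, h i d = v d := fun i hi =>
      (hran (h i)).1 ⟨i, hi, rfl⟩ d (by simp [hd])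
    have hdiff : ∀ i j, i < 2 ^ D → j < 2 ^ D → h i ≠ flipAt (h j) d := by
      intro i j hi hj e
      have := congrFun e d
      rw [flipAt_same, hhd i hi, hhd j hj] at this
      simp at this
    refine ⟨fun i => if i < 2 ^ D then h i else flipAt (h (2 * 2 ^ D - 1 - i)) d,
      ?_, ?_, ?_, ?_, ?_⟩
    · simp [h0]
    · intro i hi
      dsimp only
      rcases lt_trichotomy (i + 1) (2 ^ D) with hlt | heq | hgt
      · rw [if_pos (by omega), if_pos hlt]
        exact hadj i hlt
      · rw [if_pos (by omega), if_neg (by omega), show 2 * 2 ^ D - 1 - (i + 1) = i by omega]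
        exact hypercube_adj.2 ⟨d, rfl⟩
      · rw [if_neg (by omega), if_neg (by omega)]
        obtain ⟨t, ht⟩ := hypercube_adj.1 (hadj (2 * 2 ^ D - 1 - (i + 1)) (by omega))
        rw [show 2 * 2 ^ D - 1 - (i + 1) + 1 = 2 * 2 ^ D - 1 - i by omega] at ht
        refine SimpleGraph.Adj.symm (hypercube_adj.2 ⟨t, ?_⟩)
        rw [ht, flipAt_comm]
    · intro i j hi hj e
      dsimp only at e
      split_ifs at e with h1 h2 h2
      · exact hinj i j h1 h2 e
      · exact absurd e (hdiff _ _ h1 (by omega))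
      · exact absurd e.symm (hdiff _ _ h2 (by omega))
      · have := hinj _ _ (by omega) (by omega) (flipAt_injective d e)
        omega
    · intro x
      constructor
      · rintro ⟨i, hi, rfl⟩ j hj
        have hjd : j ≠ d := by
          rintro rfl
          simp [hd] at hj
        dsimp only
        split_ifs with h1
        · exact (hran (h i)).1 ⟨i, h1, rfl⟩ j (by omega)
        · rw [flipAt_ne _ hjd]
          exact (hran (h _)).1 ⟨2 * 2 ^ D - 1 - i, by omega, rfl⟩ j (by omega)
      · intro hx
        by_cases hxd : x d = v d
        · obtain ⟨i, hi, rfl⟩ := (hran x).2 fun j hj => by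
            by_cases hjd : j = d
            · rw [hjd, hxd]
            · refine hx j ?_
              have : (j : ℕ) ≠ D := fun e => hjd (Fin.ext e)
              omega
          exact ⟨i, by omega, by simp [hi]⟩
        · obtain ⟨i, hi, hix⟩ := (hran (flipAt x d)).2 fun j hj => by
            by_cases hjd : j = d
            · rw [hjd, flipAt_same]
              revert hxd
              cases x d <;> cases v d <;> simp
            · rw [flipAt_ne _ hjd]
              refine hx j ?_
              have : (j : ℕ) ≠ D := fun e => hjd (Fin.ext e)
              omega
          refine ⟨2 * 2 ^ D - 1 - i, by omega, ?_⟩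
          dsimp only
          rw [if_neg (by omega), show 2 * 2 ^ D - 1 - (2 * 2 ^ D - 1 - i) = i by omega, hix,
            flipAt_flipAt]
    · intro _
      dsimp only
      rw [if_neg (by omega), if_pos hpos, show 2 * 2 ^ D - 1 - (2 ^ (D + 1) - 1) = 0 by omega]
      exact SimpleGraph.Adj.symm (hypercube_adj.2 ⟨d, rfl⟩)

lemma card_subcube {n : ℕ} (D : ℕ) (hD : D ≤ n) (v : Fin n → Bool) :
    (Finset.univ.filter fun x : Fin n → Bool => ∀ j : Fin n, D ≤ j → x j = v j).card = 2 ^ D := by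
  obtain ⟨h, -, -, hinj, hran, -⟩ := exists_gray D hD v
  rw [← Finset.card_range (2 ^ D)]
  symm
  refine Finset.card_bij (fun i _ => h i) ?_ ?_ ?_
  · intro i hi
    simpa using (hran (h i)).1 ⟨i, by simpa using hi, rfl⟩
  · intro i hi j hj e
    exact hinj i j (by simpa using hi) (by simpa using hj) e
  · intro x hx
    obtain ⟨i, hi, e⟩ := (hran x).2 (by simpa using hx)
    exact ⟨i, by simpa using hi, e⟩

lemma card_even_subcube {n : ℕ} (D : ℕ) (h0 : 0 < D) (hD : D ≤ n) (v : Fin n → Bool) :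
    (Finset.univ.filter fun x : Fin n → Bool =>
      (∀ j : Fin n, D ≤ j → x j = v j) ∧ weight x % 2 = 0).card = 2 ^ (D - 1) := by
  have hc := card_subcube D hD v
  rw [← Finset.card_filter_add_card_filter_not (fun x => weight x % 2 = 0), Finset.filter_filter,
    Finset.filter_filter] at hc
  set d : Fin n := ⟨0, by omega⟩
  have hfl : ∀ x : Fin n → Bool, (∀ j : Fin n, D ≤ j → x j = v j) →
      ∀ j : Fin n, D ≤ j → flipAt x d j = v j := by
    intro x hx j hj
    rw [flipAt_ne, hx j hj]
    rintro rfl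
    simp [d] at hj
    omega
  have : (Finset.univ.filter fun x : Fin n → Bool =>
      (∀ j : Fin n, D ≤ j → x j = v j) ∧ weight x % 2 = 0).card =
      (Finset.univ.filter fun x : Fin n → Bool =>
      (∀ j : Fin n, D ≤ j → x j = v j) ∧ ¬ weight x % 2 = 0).card := by
    refine Finset.card_bij' (fun x _ => flipAt x d) (fun x _ => flipAt x d) ?_ ?_ ?_ ?_
    · intro x hx
      simp only [Finset.mem_filter, Finset.mem_univ, true_and] at hx ⊢
      have := weight_flipAt x d
      exact ⟨hfl x hx.1, by omega⟩
    · intro x hx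
      simp only [Finset.mem_filter, Finset.mem_univ, true_and] at hx ⊢
      have := weight_flipAt x d
      exact ⟨hfl x hx.1, by omega⟩
    · intro x _
      exact flipAt_flipAt x d
    · intro x _
      exact flipAt_flipAt x d
  rw [← this] at hc
  have h2 : 2 ^ D = 2 * 2 ^ (D - 1) := by
    rw [← pow_succ']
    congr 1
    omega
  omega

/-- Adjacency in the prism over a cycle of length `L`; `(false, i)` and `(true, i)` are the two
copies of the `i`-th vertex of the cycle. -/
def PrismAdj (L : ℕ) (p q : Bool × ℕ) : Prop :=
  (p.1 = q.1 ∧ (p.2 + 1 = q.2 ∨ q.2 + 1 = p.2 ∨ (p.2 + 1 = L ∧ q.2 = 0))) ∨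
    (p.1 ≠ q.1 ∧ p.2 = q.2)

/-- There is a path `l` in the prism from `w` to `p`; `F` and `T` are the sets of indices of its
vertices on the two copies of the cycle. Those of its vertices that belong to the colour class `a`
are required to have property `J` if they lie on the second copy. -/
def PrismPath (L a : ℕ) (J : ℕ → Prop) (w p : Bool × ℕ) (F T : ℕ → Prop) : Prop :=
  ∃ l : List (Bool × ℕ), (p :: l).Nodup ∧ (p :: l).IsChain (PrismAdj L) ∧
    (p :: l).getLast? = some w ∧ (∀ i, (false, i) ∈ p :: l ↔ F i) ∧
    (∀ i, (true, i) ∈ p :: l ↔ T i) ∧ (∀ q ∈ p :: l, q.2 < L) ∧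
    ∀ i, T i → (i + 1) % 2 = a → J i

lemma PrismPath.singleton_false {L a : ℕ} {J : ℕ → Prop} {i : ℕ} (hi : i < L) :
    PrismPath L a J (false, i) (false, i) (fun j => j = i) (fun _ => False) :=
  ⟨[], by simp, by simp, rfl, by simp, by simp, by simpa, by simp⟩

lemma PrismPath.singleton_true {L a : ℕ} {J : ℕ → Prop} {i : ℕ} (hi : i < L)
    (hs : (i + 1) % 2 ≠ a) :
    PrismPath L a J (true, i) (true, i) (fun _ => False) (fun j => j = i) :=
  ⟨[], by simp, by simp, rfl, by simp, by simp, by simpa, by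
    rintro j rfl h
    exact absurd h hs⟩

lemma PrismPath.cons_false {L a : ℕ} {J : ℕ → Prop} {w p : Bool × ℕ} {F T : ℕ → Prop}
    (h : PrismPath L a J w p F T) (i : ℕ) (hq : PrismAdj L (false, i) p) (hL : i < L)
    (hn : ¬ F i) : PrismPath L a J w (false, i) (fun j => j = i ∨ F j) T := by
  obtain ⟨l, hnd, hch, hla, hF, hT, hlt, hsel⟩ := h
  refine ⟨p :: l, List.nodup_cons.2 ⟨by rwa [hF], hnd⟩, List.isChain_cons_cons.2 ⟨hq, hch⟩, ?_,
    fun j => ?_, fun j => ?_, fun q hq => ?_, hsel⟩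
  · rwa [List.getLast?_cons_cons]
  · rw [List.mem_cons, hF, Prod.mk.injEq]
    simp
  · rw [List.mem_cons, hT, Prod.mk.injEq]
    simp
  · rcases List.mem_cons.1 hq with rfl | hq
    · exact hL
    · exact hlt q hq

lemma PrismPath.cons_true {L a : ℕ} {J : ℕ → Prop} {w p : Bool × ℕ} {F T : ℕ → Prop}
    (h : PrismPath L a J w p F T) (i : ℕ) (hq : PrismAdj L (true, i) p) (hL : i < L)
    (hn : ¬ T i) (hJ : (i + 1) % 2 = a → J i) :
    PrismPath L a J w (true, i) F (fun j => j = i ∨ T j) := by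
  obtain ⟨l, hnd, hch, hla, hF, hT, hlt, hsel⟩ := h
  refine ⟨p :: l, List.nodup_cons.2 ⟨by rwa [hT], hnd⟩, List.isChain_cons_cons.2 ⟨hq, hch⟩, ?_,
    fun j => ?_, fun j => ?_, fun q hq => ?_, ?_⟩
  · rwa [List.getLast?_cons_cons]
  · rw [List.mem_cons, hF, Prod.mk.injEq]
    simp
  · rw [List.mem_cons, hT, Prod.mk.injEq]
    simp
  · rcases List.mem_cons.1 hq with rfl | hq
    · exact hL
    · exact hlt q hq
  · rintro j (rfl | hj) hja
    · exact hJ hja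
    · exact hsel j hj hja

lemma exists_prismPath_false {M : ℕ} (J : ℕ → Prop) (hJ : ∃ q < M, ¬ J (2 * q)) :
    ∃ b i F T, PrismPath (2 * M) 1 J (false, 0) (b, i) F T ∧ (i + b.toNat) % 2 ≠ 1 ∧
      (∀ j < 2 * M, j % 2 = 1 → F j) ∧ (∀ j < 2 * M, j % 2 = 0 → J j → T j) := by
  classical
  obtain ⟨q, ⟨hqM, hq⟩, hmin⟩ : ∃ q, (q < M ∧ ¬ J (2 * q)) ∧ ∀ r < q, J (2 * r) :=
    ⟨Nat.find hJ, Nat.find_spec hJ, fun r hr => by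
      have := Nat.find_min hJ hr
      have := (Nat.find_spec hJ).1
      by_contra hn
      exact Nat.find_min hJ hr ⟨by omega, hn⟩⟩
  clear hJ
  have hzigzag : ∀ r ≤ q, ∃ F T, PrismPath (2 * M) 1 J (false, 0) (false, 2 * r) F T ∧
      (∀ i, F i → i ≤ 2 * r) ∧ (∀ i, T i → i < 2 * r) ∧
      (∀ j < 2 * r, j % 2 = 1 → F j) ∧ (∀ j < 2 * r, j % 2 = 0 → T j) := by
    intro r
    induction r with
    | zero =>
      intro _
      exact ⟨_, _, .singleton_false (by omega), by grind, by grind, by omega, by omega⟩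
    | succ r ih =>
      intro hr
      obtain ⟨F, T, hp, hinF, hinT, hF, hT⟩ := ih (by omega)
      have hJr := hmin r (by omega)
      clear ih hmin
      have h1 := hp.cons_true (2 * r) (by simp [PrismAdj]) (by omega) (by grind) (by grind)
      have h2 := h1.cons_true (2 * r + 1) (by simp [PrismAdj]) (by omega) (by grind) (by grind)
      have h3 := h2.cons_false (2 * r + 1) (by simp [PrismAdj]) (by omega) (by grind)
      have h4 := h3.cons_false (2 * (r + 1)) (by simp [PrismAdj]; omega) (by omega) (by grind)
      exact ⟨_, _, h4, by grind, by grind, by grind, by grind⟩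
  clear hmin
  have hsweep : ∀ r, q ≤ r → r < M → ∃ F T, PrismPath (2 * M) 1 J (false, 0) (false, 2 * r) F T ∧
      (∀ i, F i → i ≤ 2 * r) ∧ (∀ i, T i → i ≤ 2 * r) ∧
      (∀ j ≤ 2 * r, j % 2 = 1 → F j) ∧ (∀ j ≤ 2 * r, j % 2 = 0 → J j → T j) := by
    intro r hr
    induction r, hr using Nat.le_induction with
    | base =>
      intro _
      obtain ⟨F, T, hp, hinF, hinT, hF, hT⟩ := hzigzag q le_rfl
      clear hzigzag
      exact ⟨F, T, hp, by grind, by grind, by grind, by grind⟩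
    | succ r hr ih =>
      intro hrM
      obtain ⟨F, T, hp, hinF, hinT, hF, hT⟩ := ih (by omega)
      clear ih hzigzag
      have h1 := hp.cons_false (2 * r + 1) (by simp [PrismAdj]) (by omega) (by grind)
      by_cases hJr : J (2 * (r + 1))
      · have h2 := h1.cons_true (2 * r + 1) (by simp [PrismAdj]) (by omega) (by grind) (by grind)
        have h3 := h2.cons_true (2 * (r + 1)) (by simp [PrismAdj]; omega) (by omega) (by grind)
          (by grind)
        have h4 := h3.cons_false (2 * (r + 1)) (by simp [PrismAdj]) (by omega) (by grind)
        exact ⟨_, _, h4, by grind, by grind, by grind, by grind⟩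
      · have h2 := h1.cons_false (2 * (r + 1)) (by simp [PrismAdj]; omega) (by omega) (by grind)
        exact ⟨_, _, h2, by grind, by grind, by grind, by grind⟩
  obtain ⟨F, T, hp, hinF, hinT, hF, hT⟩ := hsweep (M - 1) (by omega) (by omega)
  clear hzigzag hsweep
  have h1 := hp.cons_false (2 * M - 1) (by simp [PrismAdj]; omega) (by omega) (by grind)
  have h2 := h1.cons_true (2 * M - 1) (by simp [PrismAdj]) (by omega) (by grind) (by grind)
  exact ⟨_, _, _, _, h2, by simp; omega, by grind, by grind⟩

lemma exists_prismPath_true {M : ℕ} (J : ℕ → Prop) (hJ : ∃ q < M, ¬ J (2 * q + 1)) :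
    ∃ b i F T, PrismPath (2 * M) 0 J (true, 0) (b, i) F T ∧ (i + b.toNat) % 2 ≠ 0 ∧
      (∀ j < 2 * M, j % 2 = 0 → F j) ∧ (∀ j < 2 * M, j % 2 = 1 → J j → T j) := by
  classical
  obtain ⟨q, ⟨hqM, hq⟩, hmin⟩ : ∃ q, (q < M ∧ ¬ J (2 * q + 1)) ∧ ∀ r < q, J (2 * r + 1) :=
    ⟨Nat.find hJ, Nat.find_spec hJ, fun r hr => by
      have := Nat.find_min hJ hr
      have := (Nat.find_spec hJ).1
      by_contra hn
      exact Nat.find_min hJ hr ⟨by omega, hn⟩⟩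
  clear hJ
  have hboth : ∀ r ≤ q, ∃ F T, PrismPath (2 * M) 0 J (true, 0) (true, 2 * r) F T ∧
      (∀ i, ¬ F i) ∧ (∀ i, T i → i ≤ 2 * r) ∧ (∀ j ≤ 2 * r, j % 2 = 1 → T j) := by
    intro r
    induction r with
    | zero =>
      intro _
      exact ⟨_, _, .singleton_true (by omega) (by simp), by grind, by grind, by omega⟩
    | succ r ih =>
      intro hr
      obtain ⟨F, T, hp, hinF, hinT, hT⟩ := ih (by omega)
      have hJr := hmin r (by omega)
      clear ih hmin
      have h1 := hp.cons_true (2 * r + 1) (by simp [PrismAdj]) (by omega) (by grind) (by grind)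
      have h2 := h1.cons_true (2 * (r + 1)) (by simp [PrismAdj]; omega) (by omega) (by grind)
        (by grind)
      exact ⟨_, _, h2, by grind, by grind, by grind⟩
  clear hmin
  have hback : ∀ s ≤ q, ∃ b i F T, PrismPath (2 * M) 0 J (true, 0) (b, i) F T ∧
      PrismAdj (2 * M) (false, 2 * (q - s)) (b, i) ∧
      (∀ i, T i → i ≤ 2 * q) ∧ (∀ i, F i → 2 * (q - s) < i ∧ i ≤ 2 * q) ∧
      (∀ j ≤ 2 * q, j % 2 = 1 → T j) ∧
      (∀ j ≤ 2 * q, 2 * (q - s) < j → j % 2 = 0 → F j) := by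
    intro s
    induction s with
    | zero =>
      intro _
      obtain ⟨F, T, hp, hinF, hinT, hT⟩ := hboth q le_rfl
      exact ⟨_, _, F, T, hp, by simp [PrismAdj], hinT, fun i hi => absurd hi (hinF i), hT, by omega⟩
    | succ s ih =>
      intro hs
      obtain ⟨b, i, F, T, hp, hadj, hinT, hinF, hT, hF⟩ := ih (by omega)
      clear ih hboth
      obtain ⟨u, hu⟩ : ∃ u, u = q - s := ⟨_, rfl⟩
      rw [show q - (s + 1) = u - 1 by omega]
      rw [← hu] at hadj hinF hF
      have h1 := hp.cons_false _ hadj (by omega) (by grind)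
      have h2 := h1.cons_false (2 * u - 1) (by simp [PrismAdj]; omega) (by omega) (by grind)
      exact ⟨_, _, _, _, h2, by simp [PrismAdj]; omega, by grind, by grind, by grind, by grind⟩
  clear hboth
  have hreturn : ∀ s < M - q, ∃ F T, PrismPath (2 * M) 0 J (true, 0)
        (false, 2 * (M - 1 - s) + 1) F T ∧
      (∀ i, T i → i ≤ 2 * q ∨ 2 * (M - 1 - s) + 2 ≤ i) ∧
      (∀ i, F i → i ≤ 2 * q ∨ 2 * (M - 1 - s) + 1 ≤ i) ∧
      (∀ j < 2 * M, j % 2 = 1 → j ≤ 2 * q ∨ 2 * (M - 1 - s) + 1 < j → J j → T j) ∧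
      (∀ j < 2 * M, j % 2 = 0 → j ≤ 2 * q ∨ 2 * (M - 1 - s) + 1 < j → F j) := by
    intro s
    induction s with
    | zero =>
      intro _
      obtain ⟨b, i, F, T, hp, hadj, hinT, hinF, hT, hF⟩ := hback q le_rfl
      clear hback
      rw [Nat.sub_self] at hadj hinF hF
      obtain ⟨u, hu⟩ : ∃ u, M = u + 1 := ⟨M - 1, by omega⟩
      rw [show M - 1 - 0 = u by omega]
      have h1 := hp.cons_false _ hadj (by omega) (by grind)
      have h2 := h1.cons_false (2 * u + 1) (by simp [PrismAdj]; omega) (by omega) (by grind)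
      clear hadj hp h1
      exact ⟨_, _, h2, by grind, by grind, by grind, by grind⟩
    | succ s ih =>
      intro hs
      obtain ⟨F, T, hp, hinT, hinF, hT, hF⟩ := ih (by omega)
      clear ih hback
      obtain ⟨u, hu⟩ : ∃ u, u + 1 = M - 1 - s := ⟨M - 1 - s - 1, by omega⟩
      have hu' : M - 1 - (s + 1) = u := by omega
      rw [← hu] at hp hinT hinF hT hF
      rw [hu']
      have huq : q ≤ u := by omega
      have huM : u + 1 < M := by omega
      clear hu hu' hs
      by_cases hJr : J (2 * (u + 1) + 1)
      · have h1 := hp.cons_true (2 * (u + 1) + 1) (by simp [PrismAdj]) (by omega) (by grind)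
          (by grind)
        have h2 := h1.cons_true (2 * (u + 1)) (by simp [PrismAdj]) (by omega) (by grind) (by grind)
        have h3 := h2.cons_false (2 * (u + 1)) (by simp [PrismAdj]) (by omega) (by grind)
        have h4 := h3.cons_false (2 * u + 1) (by simp [PrismAdj]; omega) (by omega) (by grind)
        clear h1 h2 h3 hp
        exact ⟨_, _, h4, by grind, by grind, by grind, by grind⟩
      · have h1 := hp.cons_false (2 * (u + 1)) (by simp [PrismAdj]) (by omega) (by grind)
        have h2 := h1.cons_false (2 * u + 1) (by simp [PrismAdj]; omega) (by omega) (by grind)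
        clear h1 hp
        exact ⟨_, _, h2, by grind, by grind, by grind, by grind⟩
  obtain ⟨F, T, hp, hinT, hinF, hT, hF⟩ := hreturn (M - 1 - q) (by omega)
  rw [show M - 1 - (M - 1 - q) = q by omega] at hp hinT hinF hT hF
  clear hback hreturn
  exact ⟨_, _, _, _, hp, by simp, by grind, by grind⟩

/-- The vertex with its first `D + 1` coordinates erased; its fibres are subcubes. -/
def block {n : ℕ} (D : ℕ) (x : Fin n → Bool) : Fin n → Bool :=
  fun j => if (j : ℕ) ≤ D then false else x j

lemma block_eq_iff {n D : ℕ} {x y : Fin n → Bool} :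
    block D x = block D y ↔ ∀ j : Fin n, D + 1 ≤ j → x j = y j := by
  constructor
  · intro h j hj
    have := congrFun h j
    rwa [block, block, if_neg (by omega), if_neg (by omega)] at this
  · intro h
    funext j
    by_cases hj : (j : ℕ) ≤ D
    · simp [block, hj]
    · simp [block, hj, h j (by omega)]

lemma block_flipAt_of_le {n D : ℕ} (x : Fin n → Bool) {j : Fin n} (hj : (j : ℕ) ≤ D) :
    block D (flipAt x j) = block D x := by
  rw [block_eq_iff]
  intro t ht
  refine flipAt_ne _ ?_
  rintro rfl
  omega

lemma block_flipAt_ne_of_lt {n D : ℕ} (x : Fin n → Bool) {j : Fin n} (hj : D < j) :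
    block D (flipAt x j) ≠ block D x := by
  rw [Ne, block_eq_iff]
  intro h
  have := h j hj
  rw [flipAt_same] at this
  simp at this

lemma block_eq_of_flipAt {n D : ℕ} {x : Fin n → Bool} {j t : Fin n} (hj : D < j)
    (h : block D (flipAt x t) = block D (flipAt x j)) : t = j := by
  by_contra hne
  have := block_eq_iff.1 h j hj
  rw [flipAt_same, flipAt_ne _ (Ne.symm hne)] at this
  simp at this

/-- `s` is an even vertex joined to `o`: either `s` is in `S` and `o` lies in the same block, or `s`
is outside of `S` and related to `o` by `A`. -/
def Link {n : ℕ} (D : ℕ) (S : Finset (Fin n → Bool)) (A : (Fin n → Bool) → (Fin n → Bool) → Prop)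
    (s o : Fin n → Bool) : Prop :=
  weight s % 2 = 0 ∧ (hypercube n).Adj s o ∧ ((s ∈ S ∧ block D s = block D o) ∨ (s ∉ S ∧ A s o))

/-- The graph whose edges are the linked pairs. -/
def linkGraph {n : ℕ} (D : ℕ) (S : Finset (Fin n → Bool))
    (A : (Fin n → Bool) → (Fin n → Bool) → Prop) : SimpleGraph (Fin n → Bool) where
  Adj u v := Link D S A u v ∨ Link D S A v u
  symm := ⟨fun _ _ h => h.symm⟩
  loopless := ⟨fun _ h => (h.elim id id).2.1.ne rfl⟩

/-- `S` consists of even vertices, contains all even vertices whose `D`-th coordinate is `0`, and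
meets every block in `m` vertices. -/
structure IsCore {n : ℕ} (D m : ℕ) (S : Finset (Fin n → Bool)) : Prop where
  even : ∀ s ∈ S, weight s % 2 = 0
  mem : ∀ s, weight s % 2 = 0 → (∀ j : Fin n, (j : ℕ) = D → s j = false) → s ∈ S
  card : ∀ y, (S.filter fun s => block D s = block D y).card = m

lemma length_of_alternating {α : Type*} (c : α → Bool) (l : List α) :
    ∀ x, (x :: l).IsChain (fun y z => c y ≠ c z) →
      (∀ z, (x :: l).getLast? = some z → c z = false) →
      (x :: l).length = 2 * (x :: l).countP c + if c x then 0 else 1 := by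
  induction l with
  | nil =>
    intro x _ h
    simp [h x rfl]
  | cons y l ih =>
    intro x h hl
    rw [List.isChain_cons_cons] at h
    rw [List.getLast?_cons_cons] at hl
    have := ih y h.2 hl
    rw [List.length_cons, this, List.countP_cons (l := y :: l)]
    have h1 := h.1
    cases hx : c x <;> cases hy : c y <;> simp_all
    omega

lemma IsCore.exists_path {n D m : ℕ} {S : Finset (Fin n → Bool)} (hD : 0 < D) (hDn : D < n)
    (hS : IsCore D m S) (hm : m < 2 ^ D) (A : (Fin n → Bool) → (Fin n → Bool) → Prop)
    (w : Fin n → Bool) (hw : weight w % 2 = 1) :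
    ∃ l : List (Fin n → Bool), (w :: l).Nodup ∧ (w :: l).IsChain (linkGraph D S A).Adj ∧
      l.length = 2 * m ∧
      ∀ x ∈ w :: l, block D x = block D w ∧ (weight x % 2 = 0 → x ∈ S) := by
  classical
  set d : Fin n := ⟨D, hDn⟩ with hd
  set v : Fin n → Bool := if w d then flipAt w d else w with hv
  have hvd : v d = false := by
    rw [hv]
    split_ifs with h
    · rw [flipAt_same, h]
      rfl
    · simpa using h
  have hbv : block D v = block D w := by
    rw [hv]
    split_ifs
    · exact block_flipAt_of_le _ le_rfl
    · rfl
  obtain ⟨h, h0, hadj, hinj, hran, hclose⟩ := exists_gray D hDn.le v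
  obtain ⟨M, hM⟩ : ∃ M, 2 ^ D = 2 * M := ⟨2 ^ (D - 1), by rw [← pow_succ']; congr 1; omega⟩
  rw [hM] at hadj hinj hran hclose
  have hMpos : 0 < M := by
    have : 0 < 2 ^ D := by positivity
    omega
  have hhran : ∀ i < 2 * M, ∀ j : Fin n, D ≤ j → h i j = v j := fun i hi =>
    (hran (h i)).1 ⟨i, hi, rfl⟩
  have hhd : ∀ i < 2 * M, h i d = false := fun i hi => by rw [hhran i hi d le_rfl, hvd]
  have hpar : ∀ i < 2 * M, (weight (h i) + weight v + i) % 2 = 0 := by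
    intro i
    induction i with
    | zero =>
      intro _
      rw [h0]
      omega
    | succ i ih =>
      intro hi
      have := ih (by omega)
      have := weight_of_adj (hadj i hi)
      omega
  set f : Bool × ℕ → Fin n → Bool := fun p => if p.1 then flipAt (h p.2) d else h p.2 with hf
  have hfF : ∀ i, f (false, i) = h i := fun i => rfl
  have hfT : ∀ i, f (true, i) = flipAt (h i) d := fun i => rfl
  have hfb : ∀ p : Bool × ℕ, p.2 < 2 * M → block D (f p) = block D w := by
    rintro ⟨b, i⟩ hi
    have : block D (h i) = block D w := by
      rw [← hbv, block_eq_iff]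
      exact fun j hj => hhran i hi j (by omega)
    cases b
    · exact this
    · rw [hfT, block_flipAt_of_le (j := d) _ le_rfl, this]
  have hfpar : ∀ p : Bool × ℕ, p.2 < 2 * M →
      (weight (f p) + weight v + p.2 + p.1.toNat) % 2 = 0 := by
    rintro ⟨b, i⟩ hi
    have := hpar i hi
    have := weight_flipAt (h i) d
    cases b
    · simp [hfF]
      omega
    · simp [hfT]
      omega
  have hfinj : ∀ p q : Bool × ℕ, p.2 < 2 * M → q.2 < 2 * M → f p = f q → p = q := by
    rintro ⟨b, i⟩ ⟨c, j⟩ hi hj e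
    have hdc := congrFun e d
    cases b <;> cases c
    · rw [hinj i j hi hj e]
    · rw [hfF, hfT, flipAt_same, hhd i hi, hhd j hj] at hdc
      simp at hdc
    · rw [hfF, hfT, flipAt_same, hhd i hi, hhd j hj] at hdc
      simp at hdc
    · rw [hinj i j hi hj (flipAt_injective d e)]
  have hfadj : ∀ p q : Bool × ℕ, p.2 < 2 * M → q.2 < 2 * M → PrismAdj (2 * M) p q →
      (hypercube n).Adj (f p) (f q) := by
    have hcyc : ∀ i j, i < 2 * M → j < 2 * M →
        (i + 1 = j ∨ j + 1 = i ∨ (i + 1 = 2 * M ∧ j = 0)) → (hypercube n).Adj (h i) (h j) := by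
      rintro i j hi hj (rfl | rfl | ⟨h1, rfl⟩)
      · exact hadj i hj
      · exact (hadj j hi).symm
      · rw [show i = 2 * M - 1 by omega]
        exact hclose hD
    rintro ⟨b, i⟩ ⟨c, j⟩ hi hj (⟨rfl, hij⟩ | ⟨hbc, rfl⟩)
    · have := hcyc i j hi hj hij
      cases b
      · exact this
      · obtain ⟨t, ht⟩ := hypercube_adj.1 this
        rw [hfT, hfT, hypercube_adj]
        exact ⟨t, by rw [ht, flipAt_comm]⟩
    · cases b <;> cases c <;> simp at hbc
      · exact hypercube_adj.2 ⟨d, rfl⟩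
      · exact (hypercube_adj.2 ⟨d, rfl⟩ : (hypercube n).Adj (h i) (f (true, i))).symm
  have hfsurj : ∀ x, block D x = block D w → ∃ p : Bool × ℕ, p.2 < 2 * M ∧ f p = x := by
    intro x hx
    rw [← hbv, block_eq_iff] at hx
    have hcase : ∀ j : Fin n, D ≤ j → j = d ∨ D + 1 ≤ j := by
      intro j hj
      rcases Nat.eq_or_lt_of_le hj with h | h
      · exact Or.inl (Fin.ext h.symm)
      · exact Or.inr h
    by_cases hxd : x d = false
    · obtain ⟨i, hi, e⟩ := (hran x).2 fun j hj => by
        rcases hcase j hj with rfl | hj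
        · rw [hxd, hvd]
        · exact hx j hj
      exact ⟨(false, i), hi, e⟩
    · obtain ⟨i, hi, e⟩ := (hran (flipAt x d)).2 fun j hj => by
        rcases hcase j hj with rfl | hj
        · rw [flipAt_same, hvd]
          simpa using hxd
        · rw [flipAt_ne, hx j hj]
          rintro rfl
          simp [hd] at hj
      exact ⟨(true, i), hi, by rw [hfT, e, flipAt_flipAt]⟩
  have hmemF : ∀ i < 2 * M, weight (h i) % 2 = 0 → h i ∈ S := fun i hi he =>
    hS.mem _ he fun j hj => by rw [show j = d from Fin.ext hj, hhd i hi]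
  obtain ⟨i₁, hi₁, hi₁e, hi₁S⟩ : ∃ i < 2 * M, weight (f (true, i)) % 2 = 0 ∧ f (true, i) ∉ S := by
    obtain ⟨x, hx, hxS⟩ : ∃ x ∈ Finset.univ.filter fun x : Fin n → Bool =>
        (∀ j : Fin n, D + 1 ≤ j → x j = w j) ∧ weight x % 2 = 0,
        x ∉ S.filter fun s => block D s = block D w := by
      apply Finset.exists_mem_notMem_of_card_lt_card
      rw [hS.card, card_even_subcube (D + 1) (by omega) (by omega)]
      exact hm
    simp only [Finset.mem_filter, Finset.mem_univ, true_and] at hx hxS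
    have hxb : block D x = block D w := block_eq_iff.2 hx.1
    obtain ⟨⟨b, i⟩, hi, rfl⟩ := hfsurj x hxb
    cases b
    · exact absurd ⟨hmemF i hi hx.2, hxb⟩ hxS
    · exact ⟨i, hi, hx.2, fun hc => hxS ⟨hc, hxb⟩⟩
  have hi₁p := hfpar (true, i₁) hi₁
  simp only [Bool.toNat_true] at hi₁p
  obtain ⟨a, b₀, p, l, hw0, ha, hnd, hch, hla, hlt, hsel, hhead, hcov⟩ :
      ∃ (a : ℕ) (b₀ : Bool) (p : Bool × ℕ) (l : List (Bool × ℕ)), f (b₀, 0) = w ∧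
        (∀ p : Bool × ℕ, p.2 < 2 * M → (weight (f p) % 2 = 0 ↔ (p.2 + p.1.toNat) % 2 = a)) ∧
        (p :: l).Nodup ∧ (p :: l).IsChain (PrismAdj (2 * M)) ∧
        (p :: l).getLast? = some (b₀, 0) ∧ (∀ q ∈ p :: l, q.2 < 2 * M) ∧
        (∀ q ∈ p :: l, weight (f q) % 2 = 0 → f q ∈ S) ∧ weight (f p) % 2 = 1 ∧
        ∀ q : Bool × ℕ, q.2 < 2 * M → f q ∈ S → q ∈ p :: l := by
    by_cases hwd : w d = true
    · have hvw : v = flipAt w d := by rw [hv, if_pos hwd]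
      have hw' := weight_flipAt w d
      rw [← hvw] at hw'
      have ha : ∀ p : Bool × ℕ, p.2 < 2 * M →
          (weight (f p) % 2 = 0 ↔ (p.2 + p.1.toNat) % 2 = 0) := by
        intro p hp
        have := hfpar p hp
        omega
      obtain ⟨b, i, F, T, ⟨l, hnd, hch, hla, hF, hT, hlt, hsel⟩, hhead, hcF, hcT⟩ :=
        exists_prismPath_true (M := M) (fun i => f (true, i) ∈ S)
          ⟨i₁ / 2, by omega, by rwa [show 2 * (i₁ / 2) + 1 = i₁ by omega]⟩
      refine ⟨0, true, (b, i), l, ?_, ha, hnd, hch, hla, hlt, ?_, ?_, ?_⟩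
      · rw [hfT, h0, hvw, flipAt_flipAt]
      · rintro ⟨c, j⟩ hq he
        cases c
        · exact hmemF j (hlt _ hq) he
        · exact hsel j ((hT j).1 hq) ((ha _ (hlt _ hq)).1 he)
      · have := ha (b, i) (hlt _ List.mem_cons_self)
        simp only at this
        omega
      · rintro ⟨c, j⟩ hj hjS
        have := (ha _ hj).1 (hS.even _ hjS)
        cases c
        · exact (hF j).2 (hcF j hj this)
        · refine (hT j).2 (hcT j hj ?_ hjS)
          simp only [Bool.toNat_true] at this
          omega
    · have hvw : v = w := by rw [hv, if_neg hwd]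
      have ha : ∀ p : Bool × ℕ, p.2 < 2 * M →
          (weight (f p) % 2 = 0 ↔ (p.2 + p.1.toNat) % 2 = 1) := by
        intro p hp
        have := hfpar p hp
        rw [hvw] at this
        omega
      rw [hvw] at hi₁p
      obtain ⟨b, i, F, T, ⟨l, hnd, hch, hla, hF, hT, hlt, hsel⟩, hhead, hcF, hcT⟩ :=
        exists_prismPath_false (M := M) (fun i => f (true, i) ∈ S)
          ⟨i₁ / 2, by omega, by rwa [show 2 * (i₁ / 2) = i₁ by omega]⟩
      refine ⟨1, false, (b, i), l, ?_, ha, hnd, hch, hla, hlt, ?_, ?_, ?_⟩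
      · rw [hfF, h0, hvw]
      · rintro ⟨c, j⟩ hq he
        cases c
        · exact hmemF j (hlt _ hq) he
        · exact hsel j ((hT j).1 hq) ((ha _ (hlt _ hq)).1 he)
      · have := ha (b, i) (hlt _ List.mem_cons_self)
        simp only at this
        omega
      · rintro ⟨c, j⟩ hj hjS
        have := (ha _ hj).1 (hS.even _ hjS)
        cases c
        · exact (hF j).2 (hcF j hj this)
        · refine (hT j).2 (hcT j hj ?_ hjS)
          simp only [Bool.toNat_true] at this
          omega
  obtain ⟨t, ht⟩ : ∃ t, ((p :: l).map f).reverse = w :: t := by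
    obtain ⟨ys, hys⟩ := List.getLast?_eq_some_iff.1 hla
    exact ⟨(ys.map f).reverse, by rw [hys]; simp [hw0]⟩
  have hmem : ∀ x ∈ w :: t, ∃ q ∈ p :: l, f q = x := by
    intro x hx
    rw [← ht, List.mem_reverse, List.mem_map] at hx
    exact hx
  have hblock : ∀ x ∈ w :: t, block D x = block D w ∧ (weight x % 2 = 0 → x ∈ S) := by
    intro x hx
    obtain ⟨q, hq, rfl⟩ := hmem x hx
    exact ⟨hfb q (hlt q hq), hsel q hq⟩
  have hnodup : (w :: t).Nodup := by
    rw [← ht, List.nodup_reverse]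
    exact hnd.map_on fun q hq r hr e => hfinj q r (hlt q hq) (hlt r hr) e
  have hchain : (w :: t).IsChain (hypercube n).Adj := by
    rw [← ht, List.isChain_reverse, List.isChain_map]
    exact List.IsChain.imp_of_mem_imp
      (fun q r hq hr h => (hfadj q r (hlt q hq) (hlt r hr) h).symm) hch
  refine ⟨t, hnodup, List.IsChain.imp_of_mem_imp (fun x y hx hy h => ?_) hchain, ?_, hblock⟩
  · have hxy : block D x = block D y := (hblock x hx).1.trans (hblock y hy).1.symm
    have := weight_of_adj h
    rcases Nat.mod_two_eq_zero_or_one (weight x) with he | ho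
    · exact Or.inl ⟨he, h, Or.inl ⟨(hblock x hx).2 he, hxy⟩⟩
    · have he : weight y % 2 = 0 := by omega
      exact Or.inr ⟨he, h.symm, Or.inl ⟨(hblock y hy).2 he, hxy.symm⟩⟩
  · have hlen := length_of_alternating (fun x : Fin n → Bool => decide (weight x % 2 = 0)) t w
      (hchain.imp fun x y h => by
        have := weight_of_adj h
        simp only [ne_eq, decide_eq_decide]
        omega)
      (fun z hz => by
        rw [← ht, List.getLast?_reverse] at hz
        simp only [List.map_cons, List.head?_cons, Option.some.injEq] at hz
        rw [← hz]
        simp [hhead])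
    have hcount : (w :: t).countP (fun x => decide (weight x % 2 = 0)) = m := by
      rw [List.countP_eq_length_filter, ← List.toFinset_card_of_nodup (hnodup.filter _),
        ← hS.card w]
      congr 1
      ext x
      simp only [List.mem_toFinset, List.mem_filter, decide_eq_true_eq, Finset.mem_filter]
      constructor
      · rintro ⟨hx, he⟩
        exact ⟨(hblock x hx).2 he, (hblock x hx).1⟩
      · rintro ⟨hx, hb⟩
        obtain ⟨q, hq, rfl⟩ := hfsurj x hb
        refine ⟨?_, hS.even _ hx⟩
        rw [← ht, List.mem_reverse, List.mem_map]
        exact ⟨q, hcov q hq hx, rfl⟩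
    rw [hcount, List.length_cons] at hlen
    simp only [hw] at hlen
    simpa using hlen

lemma exists_seq_of_hasCopy {V : Type*} {G : SimpleGraph V} {k : ℕ}
    (h : HasCopy G (pathGraph (k + 1))) :
    ∃ p : ℕ → V, (∀ i j, i ≤ k → j ≤ k → p i = p j → i = j) ∧
      ∀ j < k, G.Adj (p j) (p (j + 1)) := by
  obtain ⟨f, hf⟩ := h
  refine ⟨fun j => if h : j < k + 1 then f ⟨j, h⟩ else f 0, fun i j hi hj e => ?_, fun j hj => ?_⟩
  · simp only [dif_pos (Nat.lt_succ_of_le hi), dif_pos (Nat.lt_succ_of_le hj)] at e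
    simpa using hf e
  · simp only [dif_pos (show j < k + 1 by omega), dif_pos (show j + 1 < k + 1 by omega)]
    exact f.map_rel (pathGraph_adj.2 (Or.inl rfl))

lemma hasCopy_of_list {V : Type*} {G : SimpleGraph V} {k : ℕ} (l : List V) (hl : l.Nodup)
    (hc : l.IsChain G.Adj) (hk : l.length = k + 1) : HasCopy G (pathGraph (k + 1)) := by
  refine ⟨⟨fun i => l[(i : ℕ)]'(by omega), ?_⟩, ?_⟩
  · intro a b hab
    rw [List.isChain_iff_getElem] at hc
    rcases pathGraph_adj.1 hab with h | h
    · have := hc a (by omega)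
      simpa only [h] using this
    · have := (hc b (by omega)).symm
      simpa only [h] using this
  · intro a b hab
    exact Fin.ext ((hl.getElem_inj_iff).1 hab)

lemma link_of_adj {n D : ℕ} {S : Finset (Fin n → Bool)}
    {A : (Fin n → Bool) → (Fin n → Bool) → Prop} {s o : Fin n → Bool}
    (h : (linkGraph D S A).Adj s o) (hs : weight s % 2 = 0) : Link D S A s o := by
  rcases h with h | h
  · exact h
  · have := weight_of_adj h.2.1
    have := h.1
    omega

lemma linkGraph_le {n D : ℕ} (S : Finset (Fin n → Bool))
    (A : (Fin n → Bool) → (Fin n → Bool) → Prop) : linkGraph D S A ≤ hypercube n := by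
  rintro u v (h | h)
  · exact h.2.1
  · exact h.2.1.symm

lemma IsCore.false_of_seq {n D m : ℕ} {S : Finset (Fin n → Bool)} (hS : IsCore D m S)
    (p : ℕ → Fin n → Bool) (hinj : ∀ i j, i ≤ m → j ≤ m → p i = p j → i = j)
    (hp : ∀ j ≤ m, p j ∈ S) (hb : ∀ j < m, block D (p j) = block D (p (j + 1))) : False := by
  have hb0 : ∀ j ≤ m, block D (p j) = block D (p 0) := by
    intro j
    induction j with
    | zero => exact fun _ => rfl
    | succ j ih => exact fun hj => (hb j hj).symm.trans (ih (by omega))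
  have hsub : (Finset.range (m + 1)).image p ⊆ S.filter fun s => block D s = block D (p 0) := by
    intro x hx
    obtain ⟨j, hj, rfl⟩ := Finset.mem_image.1 hx
    rw [Finset.mem_range] at hj
    exact Finset.mem_filter.2 ⟨hp j (by omega), hb0 j (by omega)⟩
  have hcard := Finset.card_le_card hsub
  rw [hS.card, Finset.card_image_of_injOn, Finset.card_range] at hcard
  · omega
  · intro i hi j hj e
    simp only [Finset.coe_range, Set.mem_Iio] at hi hj
    exact hinj i j (by omega) (by omega) e

lemma IsCore.not_hasCopy_odd {n D m : ℕ} {S : Finset (Fin n → Bool)} (hS : IsCore D m S) :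
    ¬ HasCopy (linkGraph D S fun _ _ => False) (pathGraph (2 * m + 1 + 1)) := by
  intro h
  obtain ⟨p, hinj, hadj⟩ := exists_seq_of_hasCopy h
  have hpar : ∀ j < 2 * m + 1, (weight (p j) + weight (p (j + 1))) % 2 = 1 := fun j hj =>
    weight_of_adj (linkGraph_le _ _ (hadj j hj))
  have hblock : ∀ j < 2 * m + 1, block D (p j) = block D (p (j + 1)) := by
    intro j hj
    rcases hadj j hj with ⟨-, -, ⟨-, h⟩ | ⟨-, h⟩⟩ | ⟨-, -, ⟨-, h⟩ | ⟨-, h⟩⟩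
    · exact h
    · exact h.elim
    · exact h.symm
    · exact h.elim
  have hmem : ∀ j ≤ 2 * m + 1, weight (p j) % 2 = 0 → p j ∈ S := by
    have key : ∀ u v, (linkGraph D S fun _ _ => False).Adj u v → weight u % 2 = 0 → u ∈ S := by
      intro u v h hu
      rcases (link_of_adj h hu).2.2 with h | h
      · exact h.1
      · exact h.2.elim
    intro j hj he
    rcases Nat.lt_or_ge j (2 * m + 1) with h | h
    · exact key _ _ (hadj j h) he
    · obtain rfl : j = 2 * m + 1 := by omega
      exact key _ _ (hadj (2 * m) (by omega)).symm he
  have hpar0 : ∀ j ≤ 2 * m + 1, weight (p j) % 2 = (weight (p 0) + j) % 2 := by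
    intro j
    induction j with
    | zero => simp
    | succ j ih =>
      intro hj
      have := ih (by omega)
      have := hpar j hj
      omega
  obtain ⟨e, he, he0⟩ : ∃ e, e ≤ 1 ∧ (weight (p 0) + e) % 2 = 0 :=
    ⟨weight (p 0) % 2, by omega, by omega⟩
  refine hS.false_of_seq (fun j => p (2 * j + e)) (fun i j hi hj h => ?_) (fun j hj => ?_)
    fun j hj => ?_
  · have := hinj _ _ (by omega) (by omega) h
    omega
  · refine hmem _ (by omega) ?_
    have := hpar0 (2 * j + e) (by omega)
    omega
  · have h1 := hblock (2 * j + e) (by omega)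
    have h2 := hblock (2 * j + e + 1) (by omega)
    rw [h1, h2]
    congr 2
    omega

/-- `att` sends every even vertex outside of `S` to a neighbour in another block, with at most one
image in every block. -/
structure IsAttachment {n : ℕ} (D : ℕ) (S : Finset (Fin n → Bool))
    (att : (Fin n → Bool) → Fin n → Bool) : Prop where
  adj : ∀ s ∉ S, weight s % 2 = 0 → (hypercube n).Adj s (att s)
  ne : ∀ s ∉ S, weight s % 2 = 0 → block D (att s) ≠ block D s
  inj : ∀ s ∉ S, ∀ t ∉ S, weight s % 2 = 0 → weight t % 2 = 0 →
    block D (att s) = block D (att t) → att s = att t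

lemma IsCore.not_hasCopy_even {n D m : ℕ} {S : Finset (Fin n → Bool)} (hS : IsCore D m S)
    (hm : 0 < m) {att : (Fin n → Bool) → Fin n → Bool} (hatt : IsAttachment D S att) :
    ¬ HasCopy (linkGraph D S fun s o => o = att s) (pathGraph (2 * m + 2 + 1)) := by
  intro h
  obtain ⟨p, hinj, hadj⟩ := exists_seq_of_hasCopy h
  have hmid : ∀ j < 2 * m + 1, weight (p (j + 1)) % 2 = 0 → p (j + 1) ∈ S ∧
      block D (p (j + 1)) = block D (p j) ∧ block D (p (j + 1)) = block D (p (j + 2)) := by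
    intro j hj he
    have h1 := (link_of_adj (hadj j (by omega)).symm he).2.2
    have h2 := (link_of_adj (hadj (j + 1) (by omega)) he).2.2
    by_cases hs : p (j + 1) ∈ S
    · simp only [hs, not_true_eq_false, false_and, or_false, true_and] at h1 h2
      exact ⟨hs, h1, h2⟩
    · simp only [hs, not_false_eq_true, false_and, false_or, true_and] at h1 h2
      have := hinj j (j + 2) (by omega) (by omega) (h1.trans h2.symm)
      omega
  have hpar0 : ∀ j ≤ 2 * m + 2, weight (p j) % 2 = (weight (p 0) + j) % 2 := by
    intro j
    induction j with
    | zero => simp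
    | succ j ih =>
      intro hj
      have := ih (by omega)
      have := weight_of_adj (linkGraph_le _ _ (hadj j hj))
      omega
  rcases Nat.mod_two_eq_zero_or_one (weight (p 0)) with h0 | h0
  · have hev : ∀ j < m, weight (p (2 * j + 1 + 1)) % 2 = 0 := by
      intro j hj
      have := hpar0 (2 * j + 1 + 1) (by omega)
      omega
    have hchain : ∀ j ≤ m, block D (p (2 * j + 1)) = block D (p 1) := by
      intro j
      induction j with
      | zero => exact fun _ => rfl
      | succ j ih =>
        intro hj
        have h1 := hmid (2 * j + 1) (by omega) (hev j hj)
        exact (h1.2.2.symm.trans h1.2.1).trans (ih (by omega))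
    have hlast : weight (p (2 * m + 2)) % 2 = 0 := by
      have := hpar0 (2 * m + 2) le_rfl
      omega
    have hfst : p 0 ∉ S := by
      intro hp0
      have hb := (link_of_adj (hadj 0 (by omega)) h0).2.2
      simp only [hp0, not_true_eq_false, false_and, or_false, true_and] at hb
      have hb' : ∀ j ≤ m, block D (p (2 * j)) = block D (p 1) := by
        intro j hj
        rcases j with _ | j
        · exact hb
        · exact (hmid (2 * j + 1) (by omega) (hev j hj)).2.1.trans (hchain j (by omega))
      refine hS.false_of_seq (fun j => p (2 * j)) (fun i j hi hj h => ?_) (fun j hj => ?_)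
        fun j hj => ?_
      · have := hinj _ _ (by omega) (by omega) h
        omega
      · rcases j with _ | j
        · exact hp0
        · exact (hmid (2 * j + 1) (by omega) (hev j hj)).1
      · rw [hb' j (by omega), hb' (j + 1) hj]
    have hlst : p (2 * m + 2) ∉ S := by
      intro hp0
      have hb := (link_of_adj (hadj (2 * m + 1) (by omega)).symm hlast).2.2
      simp only [hp0, not_true_eq_false, false_and, or_false, true_and] at hb
      have hb' : ∀ j ≤ m, block D (p (2 * j + 2)) = block D (p 1) := by
        intro j hj
        rcases Nat.eq_or_lt_of_le hj with rfl | hj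
        · exact hb.trans (hchain j le_rfl)
        · exact (hmid (2 * j + 1) (by omega) (hev j hj)).2.1.trans (hchain j (by omega))
      refine hS.false_of_seq (fun j => p (2 * j + 2)) (fun i j hi hj h => ?_) (fun j hj => ?_)
        fun j hj => ?_
      · have := hinj _ _ (by omega) (by omega) h
        omega
      · rcases Nat.eq_or_lt_of_le hj with rfl | hj
        · exact hp0
        · exact (hmid (2 * j + 1) (by omega) (hev j hj)).1
      · rw [hb' j (by omega), hb' (j + 1) hj]
    have h1 := (link_of_adj (hadj 0 (by omega)) h0).2.2
    have h2 := (link_of_adj (hadj (2 * m + 1) (by omega)).symm hlast).2.2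
    simp only [hfst, hlst, not_false_eq_true, false_and, false_or, true_and] at h1 h2
    have hc := hchain m le_rfl
    rw [h2, h1] at hc
    have := hatt.inj _ hlst _ hfst hlast h0 hc
    rw [← h1, ← h2] at this
    have := hinj _ _ (by omega) (by omega) this
    omega
  · have hev : ∀ j ≤ m, weight (p (2 * j + 1)) % 2 = 0 := by
      intro j hj
      have := hpar0 (2 * j + 1) (by omega)
      omega
    refine hS.false_of_seq (fun j => p (2 * j + 1)) (fun i j hi hj h => ?_) (fun j hj => ?_)
      fun j hj => ?_
    · have := hinj _ _ (by omega) (by omega) h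
      omega
    · exact (hmid (2 * j) (by omega) (hev j hj)).1
    · exact (hmid (2 * j) (by omega) (hev j (by omega))).2.2.trans
        (hmid (2 * (j + 1)) (by omega) (hev (j + 1) hj)).2.1.symm

lemma IsCore.exists_extension {n D m : ℕ} {S : Finset (Fin n → Bool)} (hD : 0 < D) (hDn : D < n)
    (hS : IsCore D m S) (hm : m < 2 ^ D) (A : (Fin n → Bool) → (Fin n → Bool) → Prop)
    {s w : Fin n → Bool} (hs : weight s % 2 = 0) (hsw : (hypercube n).Adj s w)
    (hn : ¬ (linkGraph D S A).Adj s w) :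
    ∃ l : List (Fin n → Bool), (s :: w :: l).Nodup ∧ (w :: l).IsChain (linkGraph D S A).Adj ∧
      l.length = 2 * m ∧ ∀ x ∈ w :: l, block D x = block D w := by
  have := weight_of_adj hsw
  obtain ⟨l, hnd, hch, hlen, hl⟩ := hS.exists_path hD hDn hm A w (by omega)
  refine ⟨l, List.nodup_cons.2 ⟨fun h => hn ?_, hnd⟩, hch, hlen, fun x hx => (hl x hx).1⟩
  exact Or.inl ⟨hs, hsw, Or.inl ⟨(hl s h).2 hs, (hl s h).1⟩⟩

lemma isSat_of_even {n D k : ℕ} {S : Finset (Fin n → Bool)}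
    {A : (Fin n → Bool) → (Fin n → Bool) → Prop}
    (hcopy : ¬ HasCopy (linkGraph D S A) (pathGraph (k + 1)))
    (h : ∀ s w, weight s % 2 = 0 → (hypercube n).Adj s w → ¬ (linkGraph D S A).Adj s w →
      HasCopy (linkGraph D S A ⊔ fromEdgeSet {s(s, w)}) (pathGraph (k + 1))) :
    IsSat (hypercube n) (linkGraph D S A) (pathGraph (k + 1)) := by
  refine ⟨linkGraph_le _ _, hcopy, fun u v huv hn => ?_⟩
  have := weight_of_adj huv
  rcases Nat.mod_two_eq_zero_or_one (weight u) with hu | hu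
  · exact h u v hu huv hn
  · rw [Sym2.eq_swap]
    exact h v u (by omega) huv.symm fun h => hn h.symm

lemma isChain_sup_cons {V : Type*} {G : SimpleGraph V} {s w : V} {l : List V} (hne : s ≠ w)
    (h : (w :: l).IsChain G.Adj) :
    (s :: w :: l).IsChain (G ⊔ fromEdgeSet {s(s, w)}).Adj := by
  rw [List.isChain_cons_cons]
  exact ⟨Or.inr (by simpa using hne), h.imp fun _ _ h => Or.inl h⟩

lemma IsCore.isSat_odd {n D m : ℕ} {S : Finset (Fin n → Bool)} (hD : 0 < D) (hDn : D < n)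
    (hS : IsCore D m S) (hm : m < 2 ^ D) :
    IsSat (hypercube n) (linkGraph D S fun _ _ => False) (pathGraph (2 * m + 1 + 1)) := by
  refine isSat_of_even hS.not_hasCopy_odd fun s w hs hsw hn => ?_
  obtain ⟨l, hnd, hch, hlen, -⟩ := hS.exists_extension hD hDn hm _ hs hsw hn
  exact hasCopy_of_list (s :: w :: l) hnd (isChain_sup_cons hsw.ne hch) (by simp [hlen])

lemma IsCore.isSat_even {n D m : ℕ} {S : Finset (Fin n → Bool)} (hD : 0 < D) (hDn : D < n)
    (hS : IsCore D m S) (hm0 : 0 < m) (hm : m < 2 ^ D) {att : (Fin n → Bool) → Fin n → Bool}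
    (hatt : IsAttachment D S att) :
    IsSat (hypercube n) (linkGraph D S fun s o => o = att s) (pathGraph (2 * m + 2 + 1)) := by
  refine isSat_of_even (hS.not_hasCopy_even hm0 hatt) fun s w hs hsw hn => ?_
  obtain ⟨l, hnd, hch, hlen, hl⟩ := hS.exists_extension hD hDn hm _ hs hsw hn
  obtain ⟨z, hz, hzb⟩ : ∃ z, Link D S (fun s o => o = att s) s z ∧ block D z ≠ block D w := by
    by_cases hsS : s ∈ S
    · have hb := block_flipAt_of_le s (j := ⟨0, by omega⟩) (Nat.zero_le D)
      refine ⟨flipAt s ⟨0, by omega⟩, ⟨hs, hypercube_adj.2 ⟨_, rfl⟩, Or.inl ⟨hsS, hb.symm⟩⟩, ?_⟩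
      rw [hb]
      exact fun hb' => hn (Or.inl ⟨hs, hsw, Or.inl ⟨hsS, hb'⟩⟩)
    · refine ⟨att s, ⟨hs, hatt.adj s hsS hs, Or.inr ⟨hsS, rfl⟩⟩, fun hb => ?_⟩
      obtain ⟨j, hj⟩ := hypercube_adj.1 (hatt.adj s hsS hs)
      obtain ⟨t, rfl⟩ := hypercube_adj.1 hsw
      have hDj : D < j := by
        by_contra hDj
        refine hatt.ne s hsS hs ?_
        rw [hj]
        exact block_flipAt_of_le s (by omega)
      rw [hj] at hb
      obtain rfl := block_eq_of_flipAt hDj hb.symm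
      exact hn (Or.inl ⟨hs, hsw, Or.inr ⟨hsS, hj.symm⟩⟩)
  refine hasCopy_of_list (z :: s :: w :: l) (List.nodup_cons.2 ⟨?_, hnd⟩) ?_ (by simp [hlen])
  · rw [List.mem_cons, not_or]
    exact ⟨hz.2.1.ne', fun h => hzb (hl z h)⟩
  · rw [List.isChain_cons_cons]
    exact ⟨Or.inl (Or.inr hz), isChain_sup_cons hsw.ne hch⟩

/-- The sum of the labels `c j` over the coordinates `j` at which `x` is `1`. -/
def syndrome {n : ℕ} {α : Type*} [AddCommMonoid α] (c : Fin n → α) (x : Fin n → Bool) : α :=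
  ∑ j, if x j then c j else 0

lemma syndrome_flipAt {n : ℕ} {α : Type*} [AddCommGroup α] (hα : ∀ a : α, a + a = 0)
    (c : Fin n → α) (x : Fin n → Bool) (j : Fin n) :
    syndrome c (flipAt x j) = syndrome c x + c j := by
  classical
  have hrest : ∑ i ∈ Finset.univ.erase j, (if flipAt x j i then c i else 0) =
      ∑ i ∈ Finset.univ.erase j, if x i then c i else 0 :=
    Finset.sum_congr rfl fun i hi => by rw [flipAt_ne _ (Finset.ne_of_mem_erase hi)]
  rw [syndrome, syndrome, ← Finset.add_sum_erase _ _ (Finset.mem_univ j),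
    ← Finset.add_sum_erase _ _ (Finset.mem_univ j), hrest, flipAt_same]
  cases x j
  · simp [add_comm]
  · simp only [Bool.not_true, Bool.false_eq_true, if_false, if_true, zero_add]
    rw [add_comm (c j), add_assoc, hα, add_zero]

lemma exists_isAttachment {n D : ℕ} (hn : D + 1 + 2 ^ (D + 1) ≤ n) (S : Finset (Fin n → Bool)) :
    ∃ att, IsAttachment D S att := by
  classical
  have hcard : Fintype.card (Fin (D + 1) → ZMod 2) = 2 ^ (D + 1) := by simp [ZMod.card]
  let e := Fintype.equivFinOfCardEq hcard
  let c : Fin n → Fin (D + 1) → ZMod 2 := fun j =>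
    if h : (j : ℕ) < D + 1 then Pi.single ⟨j, h⟩ 1
    else e.symm ⟨(j - (D + 1)) % 2 ^ (D + 1), Nat.mod_lt _ (by positivity)⟩
  have hα : ∀ a : Fin (D + 1) → ZMod 2, a + a = 0 := fun a => CharTwo.add_self_eq_zero a
  have hsurj : ∀ a, ∃ j : Fin n, D < j ∧ c j = a := by
    intro a
    have he := (e a).isLt
    refine ⟨⟨D + 1 + e a, by omega⟩, by simp only; omega, ?_⟩
    simp only [c]
    rw [dif_neg (by omega), Equiv.symm_apply_eq]
    ext
    simp [Nat.mod_eq_of_lt he]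
  have huniq : ∀ x y, block D x = block D y → syndrome c x = syndrome c y → x = y := by
    intro x y hb hs
    rw [block_eq_iff] at hb
    funext j
    by_cases hj : D + 1 ≤ j
    · exact hb j hj
    · have hval : ∀ z : Fin n → Bool, syndrome c z ⟨j, by omega⟩ =
          (if z j then 1 else 0) + ∑ i ∈ Finset.univ.filter fun i : Fin n => D + 1 ≤ i,
            if z i then c i ⟨j, by omega⟩ else 0 := by
        intro z
        rw [syndrome, Finset.sum_apply,
          ← Finset.sum_filter_add_sum_filter_not _ (fun i : Fin n => D + 1 ≤ i), add_comm]
        congr 1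
        · rw [Finset.sum_eq_single j]
          · simp only [c, dif_pos (show (j : ℕ) < D + 1 by omega)]
            split_ifs <;> simp
          · intro i hi hij
            simp only [Finset.mem_filter, Finset.mem_univ, true_and, not_le] at hi
            simp only [c, dif_pos hi]
            split_ifs
            · rw [Pi.single_eq_of_ne]
              intro h
              rw [Fin.mk.injEq] at h
              exact hij (Fin.ext h.symm)
            · rfl
          · intro h
            exact (h (Finset.mem_filter.2 ⟨Finset.mem_univ j, hj⟩)).elim
        · refine Finset.sum_congr rfl fun i _ => ?_
          split_ifs <;> rfl
      have h1 := congrFun hs ⟨j, by omega⟩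
      rw [hval, hval] at h1
      have h2 : (∑ i ∈ Finset.univ.filter fun i : Fin n => D + 1 ≤ i,
            if x i then c i ⟨j, by omega⟩ else 0) =
          ∑ i ∈ Finset.univ.filter fun i : Fin n => D + 1 ≤ i,
            if y i then c i ⟨j, by omega⟩ else 0 :=
        Finset.sum_congr rfl fun i hi => by rw [hb i (Finset.mem_filter.1 hi).2]
      rw [h2, add_left_inj] at h1
      cases hx : x j <;> cases hy : y j <;> simp [hx, hy] at h1 ⊢
  choose φ hφD hφ using hsurj
  have hzero : ∀ s, syndrome c (flipAt s (φ (syndrome c s))) = 0 := by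
    intro s
    rw [syndrome_flipAt hα, hφ, hα]
  exact ⟨fun s => flipAt s (φ (syndrome c s)), fun s _ _ => hypercube_adj.2 ⟨_, rfl⟩,
    fun s _ _ => block_flipAt_ne_of_lt _ (hφD _),
    fun s _ t _ _ _ h => huniq _ _ h ((hzero s).trans (hzero t).symm)⟩

lemma exists_isCore {n D m : ℕ} (hD : 0 < D) (hDn : D < n) (hm : 2 ^ (D - 1) ≤ m)
    (hm' : m ≤ 2 ^ D) : ∃ S : Finset (Fin n → Bool), IsCore D m S := by
  classical
  set d : Fin n := ⟨D, hDn⟩ with hd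
  have hex : ∀ b : Fin n → Bool, ∃ s : Finset (Fin n → Bool),
      (∀ x ∈ s, block D x = block D b ∧ weight x % 2 = 0) ∧
      (∀ x, block D x = block D b → weight x % 2 = 0 → x d = false → x ∈ s) ∧ s.card = m := by
    intro b
    have hc1 := card_even_subcube D hD hDn.le (Function.update b d false)
    have hc2 := card_even_subcube (D + 1) (by omega) (by omega) b
    obtain ⟨s, h1, h2, h3⟩ := Finset.exists_subsuperset_card_eq (n := m)
      (s := Finset.univ.filter fun x : Fin n → Bool =>
        (∀ j : Fin n, D ≤ j → x j = Function.update b d false j) ∧ weight x % 2 = 0)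
      (t := Finset.univ.filter fun x : Fin n → Bool =>
        (∀ j : Fin n, D + 1 ≤ j → x j = b j) ∧ weight x % 2 = 0)
      (fun x hx => by
        simp only [Finset.mem_filter, Finset.mem_univ, true_and] at hx ⊢
        refine ⟨fun j hj => ?_, hx.2⟩
        rw [hx.1 j (by omega), Function.update_of_ne]
        rintro rfl
        simp [hd] at hj)
      (by rwa [hc1]) (by rw [hc2]; simpa using hm')
    refine ⟨s, fun x hx => ?_, fun x hxb hxe hxd => h1 ?_, h3⟩
    · have := h2 hx
      simp only [Finset.mem_filter, Finset.mem_univ, true_and] at this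
      exact ⟨block_eq_iff.2 this.1, this.2⟩
    · simp only [Finset.mem_filter, Finset.mem_univ, true_and]
      refine ⟨fun j hj => ?_, hxe⟩
      by_cases h : j = d
      · rw [h, hxd, Function.update_self]
      · rw [Function.update_of_ne h]
        have hne : (j : ℕ) ≠ D := fun h' => h (Fin.ext h')
        exact block_eq_iff.1 hxb j (by omega)
  have hbb : ∀ x : Fin n → Bool, block D (block D x) = block D x := by
    intro x
    funext j
    simp only [block]
    split_ifs <;> rfl
  choose F hF1 hF2 hF3 using hex
  refine ⟨Finset.univ.filter fun x => x ∈ F (block D x), ⟨fun s hs => ?_, fun s hs h => ?_,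
    fun y => ?_⟩⟩
  · exact (hF1 _ s (Finset.mem_filter.1 hs).2).2
  · exact Finset.mem_filter.2 ⟨Finset.mem_univ _, hF2 _ s (hbb s).symm hs (h d rfl)⟩
  · rw [← hF3 (block D y)]
    congr 1
    ext x
    simp only [Finset.mem_filter, Finset.mem_univ, true_and]
    constructor
    · rintro ⟨h, hb⟩
      rwa [← hb]
    · intro h
      have hb := (hF1 _ x h).1
      rw [hbb] at hb
      exact ⟨by rwa [hb], hb⟩

lemma IsCore.card_mul {n D m : ℕ} {S : Finset (Fin n → Bool)} (hDn : D < n)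
    (hS : IsCore D m S) : S.card * 2 ^ (D + 1) = m * 2 ^ n := by
  classical
  have h1 : S.card = (Finset.univ.image (block (n := n) D)).card * m := by
    rw [Finset.card_eq_sum_card_fiberwise (f := block D) (t := Finset.univ.image (block D))
      fun x _ => by simp, Finset.sum_const_nat]
    intro b hb
    obtain ⟨y, -, rfl⟩ := Finset.mem_image.1 hb
    exact hS.card y
  have h2 : 2 ^ n = (Finset.univ.image (block (n := n) D)).card * 2 ^ (D + 1) := by
    have : (Finset.univ : Finset (Fin n → Bool)).card = 2 ^ n := by simp
    rw [← this, Finset.card_eq_sum_card_fiberwise (f := block D)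
      (t := Finset.univ.image (block D)) fun x _ => by simp, Finset.sum_const_nat]
    intro b hb
    obtain ⟨y, -, rfl⟩ := Finset.mem_image.1 hb
    simp only [block_eq_iff]
    exact card_subcube (D + 1) hDn y
  rw [h1, h2]
  ring

lemma card_even {n : ℕ} (hn : 0 < n) :
    (Finset.univ.filter fun x : Fin n → Bool => weight x % 2 = 0).card = 2 ^ (n - 1) := by
  rw [← card_even_subcube n hn le_rfl fun _ => false]
  congr 1
  ext x
  simp only [Finset.mem_filter, Finset.mem_univ, true_and, iff_and_self]
  intro _ j hj
  omega

lemma ncard_linkGraph_le {n D : ℕ} (S : Finset (Fin n → Bool))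
    (A : (Fin n → Bool) → (Fin n → Bool) → Prop) (R : Finset ((Fin n → Bool) × (Fin n → Bool)))
    (hR : ∀ s o, weight s % 2 = 0 → s ∉ S → A s o → (s, o) ∈ R) :
    (linkGraph D S A).edgeSet.ncard ≤ S.card * (D + 1) + R.card := by
  classical
  set J : Finset (Fin n) := Finset.univ.filter fun j => (j : ℕ) ≤ D with hJ
  have hJc : J.card ≤ D + 1 := by
    rw [← Finset.card_range (D + 1)]
    refine Finset.card_le_card_of_injOn (fun j => (j : ℕ)) (fun j hj => ?_)
      (Fin.val_injective.injOn)
    simp only [hJ, Finset.coe_filter, Set.mem_ofPred_eq, Finset.mem_univ, true_and] at hj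
    simp only [Finset.coe_range, Set.mem_Iio]
    omega
  set P := (S ×ˢ J).image (fun q => s(q.1, flipAt q.1 q.2)) ∪ R.image (fun q => s(q.1, q.2))
  have hlink : ∀ s o, Link D S A s o → s(s, o) ∈ P := by
    rintro s o ⟨he, hadj, ⟨hs, hb⟩ | ⟨hs, hA⟩⟩
    · obtain ⟨j, rfl⟩ := hypercube_adj.1 hadj
      refine Finset.mem_union_left _ (Finset.mem_image.2 ⟨(s, j), ?_, rfl⟩)
      refine Finset.mem_product.2 ⟨hs, Finset.mem_filter.2 ⟨Finset.mem_univ _, ?_⟩⟩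
      by_contra hj
      exact block_flipAt_ne_of_lt s (not_le.1 hj) hb.symm
    · exact Finset.mem_union_right _ (Finset.mem_image.2 ⟨(s, o), hR s o he hs hA, rfl⟩)
  have hsub : (linkGraph D S A).edgeSet ⊆ (P : Set (Sym2 (Fin n → Bool))) := by
    intro z
    induction z with
    | h u v =>
      rintro (h | h)
      · exact hlink u v h
      · rw [Sym2.eq_swap]
        exact hlink v u h
  calc (linkGraph D S A).edgeSet.ncard ≤ P.card := by
        rw [← Set.ncard_coe_finset]
        exact Set.ncard_le_ncard hsub P.finite_toSet
    _ ≤ (S ×ˢ J).card + R.card :=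
        (Finset.card_union_le _ _).trans (add_le_add Finset.card_image_le Finset.card_image_le)
    _ ≤ S.card * (D + 1) + R.card := by
        rw [Finset.card_product]
        gcongr

lemma ncard_linkGraph_odd_le {n D : ℕ} (S : Finset (Fin n → Bool)) :
    (linkGraph D S fun _ _ => False).edgeSet.ncard ≤ S.card * (D + 1) := by
  simpa using ncard_linkGraph_le (D := D) S (fun _ _ => False) ∅ fun _ _ _ _ h => h.elim

lemma IsCore.ncard_linkGraph_even_le {n D m : ℕ} {S : Finset (Fin n → Bool)} (hn : 0 < n)
    (hS : IsCore D m S) (att : (Fin n → Bool) → Fin n → Bool) :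
    (linkGraph D S fun s o => o = att s).edgeSet.ncard ≤ S.card * D + 2 ^ (n - 1) := by
  classical
  set E := Finset.univ.filter fun x : Fin n → Bool => weight x % 2 = 0 with hE
  have hSE : S ⊆ E := fun s hs => Finset.mem_filter.2 ⟨Finset.mem_univ _, hS.even s hs⟩
  have h := ncard_linkGraph_le (D := D) S (fun s o => o = att s)
    ((E \ S).image fun s => (s, att s)) fun s o he hs h => Finset.mem_image.2
      ⟨s, Finset.mem_sdiff.2 ⟨Finset.mem_filter.2 ⟨Finset.mem_univ _, he⟩, hs⟩, by rw [h]⟩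
  have h1 : ((E \ S).image fun s => (s, att s)).card ≤ (E \ S).card := Finset.card_image_le
  have h2 := Finset.card_sdiff_add_card_eq_card hSE
  rw [hE, card_even hn, ← hE] at h2
  rw [mul_add] at h
  omega

lemma satNum_le {V W : Type*} {Host H : SimpleGraph V} {G : SimpleGraph W} (h : IsSat Host H G) :
    satNum Host G ≤ H.edgeSet.ncard :=
  Nat.sInf_le ⟨H, h, rfl⟩

lemma IsCore.card_eq {n D m : ℕ} {S : Finset (Fin n → Bool)} (hDn : D < n) (hS : IsCore D m S) :
    (S.card : ℝ) = 2 * m / 2 ^ (D + 1) * 2 ^ (n - 1) := by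
  have h : (S.card : ℝ) * 2 ^ (D + 1) = m * 2 ^ n := by exact_mod_cast hS.card_mul hDn
  have hn : (2 : ℝ) ^ n = 2 * 2 ^ (n - 1) := by
    rw [← pow_succ']
    congr 1
    omega
  rw [hn] at h
  field_simp
  linarith

/-- upper bounds on `sat(Q_n, P_k)` for `k > 4`, where
`i = ⌊log₂(k-1)⌋` and `P_k` is the path with `k` edges (`k+1` vertices). -/
theorem stmt2 (k : ℕ) (hk : 4 < k) (i : ℕ) (hi : i = Nat.log 2 (k - 1)) :
    ∃ N : ℕ, ∀ n ≥ N,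
      (Odd k →
        (satNum (hypercube n) (SimpleGraph.pathGraph (k + 1)) : ℝ) ≤
          (i + 1) * (k - 1) / 2 ^ (i + 1) * 2 ^ (n - 1)) ∧
      (Even k →
        (satNum (hypercube n) (SimpleGraph.pathGraph (k + 1)) : ℝ) ≤
          ((i * (k - 2) : ℝ) / 2 ^ (i + 1) + 1) * 2 ^ (n - 1)) := by
  have hlow : 2 ^ i ≤ k - 1 := hi ▸ Nat.pow_log_le_self 2 (by omega)
  have hupp : k - 1 < 2 ^ (i + 1) := hi ▸ Nat.lt_pow_succ_log_self (by norm_num) _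
  have hi0 : 0 < i := hi ▸ Nat.log_pos (by norm_num) (by omega)
  have hpow : 2 ^ i = 2 * 2 ^ (i - 1) := by
    rw [← pow_succ']
    congr 1
    omega
  rw [pow_succ] at hupp
  refine ⟨i + 1 + 2 ^ (i + 1), fun n hn => ⟨?_, ?_⟩⟩
  · rintro ⟨m, rfl⟩
    obtain ⟨S, hS⟩ := exists_isCore (n := n) (m := m) hi0 (by omega) (by omega) (by omega)
    have h := (satNum_le (hS.isSat_odd hi0 (by omega) (by omega))).trans (ncard_linkGraph_odd_le S)
    have h' : (satNum (hypercube n) (pathGraph (2 * m + 1 + 1)) : ℝ) ≤ S.card * (i + 1) := by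
      exact_mod_cast h
    refine h'.trans (le_of_eq ?_)
    rw [hS.card_eq (by omega)]
    push_cast
    ring
  · rintro ⟨r, hr⟩
    obtain ⟨m, rfl⟩ : ∃ m, k = 2 * m + 2 := ⟨r - 1, by omega⟩
    obtain ⟨S, hS⟩ := exists_isCore (n := n) (m := m) hi0 (by omega) (by omega) (by omega)
    obtain ⟨att, hatt⟩ := exists_isAttachment hn S
    have h := (satNum_le (hS.isSat_even hi0 (by omega) (by omega) (by omega) hatt)).trans
      (hS.ncard_linkGraph_even_le (by omega) att)
    have h' : (satNum (hypercube n) (pathGraph (2 * m + 2 + 1)) : ℝ) ≤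
        S.card * i + 2 ^ (n - 1) := by
      exact_mod_cast h
    refine h'.trans (le_of_eq ?_)
    rw [hS.card_eq (by omega)]
    push_cast
    ring
end

section
/- For every k-regular bipartite graph H and every nonnegative integer r ≤ k, there exists a spanning subgraph G of H that is r-regular (and bipartite). -/
open SimpleGraph

/-- A regular graph of positive degree on a finite vertex set admits a permutation of its vertices
moving each vertex to one of its neighbors. -/
theorem SimpleGraph.exists_perm_adj_of_ncard_neighborSet_eq {V : Type*} [Finite V]
    (H : SimpleGraph V) {k : ℕ} (hk : 0 < k) (hreg : ∀ v : V, (H.neighborSet v).ncard = k) :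
    ∃ f : Equiv.Perm V, ∀ v, H.Adj v (f v) := by
  classical
  have := Fintype.ofFinite V
  have hdeg (v : V) : (H.neighborFinset v).card = k := by
    rw [← hreg v, Set.ncard_eq_toFinset_card']
    rfl
  obtain ⟨f, hf, hadj⟩ := (Finset.all_card_le_biUnion_card_iff_exists_injective
    fun v => H.neighborFinset v).mp fun s => by
      refine Nat.le_of_mul_le_mul_right
        (Finset.card_mul_le_card_mul H.Adj (m := k) (n := k) ?_ ?_) hk
      · intro a ha
        rw [← hdeg a]
        refine Finset.card_le_card fun b hb => ?_
        exact Finset.mem_filter.mpr ⟨Finset.mem_biUnion.mpr ⟨a, ha, hb⟩,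
          (H.mem_neighborFinset a b).mp hb⟩
      · intro b _
        rw [← hdeg b]
        refine Finset.card_le_card fun a ha => ?_
        exact (H.mem_neighborFinset b a).mpr (Finset.mem_filter.mp ha).2.symm
  exact ⟨Equiv.ofBijective f (Finite.injective_iff_bijective.mp hf),
    fun v => (H.mem_neighborFinset _ _).mp (hadj v)⟩

/-- A regular bipartite graph of positive degree has a spanning subgraph whose degree is smaller
by one. -/
theorem SimpleGraph.exists_le_ncard_neighborSet_eq_of_succ {V : Type*} [Finite V]
    (H : SimpleGraph V) {k : ℕ} (hreg : ∀ v : V, (H.neighborSet v).ncard = k + 1)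
    (c : V → Bool) (hc : ∀ u v : V, H.Adj u v → c u ≠ c v) :
    ∃ G : SimpleGraph V, G ≤ H ∧ ∀ v : V, (G.neighborSet v).ncard = k := by
  obtain ⟨f, hf⟩ := H.exists_perm_adj_of_ncard_neighborSet_eq k.succ_pos hreg
  let M : SimpleGraph V :=
    { Adj := fun u v => (c u = false ∧ f u = v) ∨ (c v = false ∧ f v = u)
      symm := ⟨fun _ _ h => h.symm⟩
      loopless := ⟨fun v h => (hf v).ne (h.elim (·.2.symm) (·.2.symm))⟩ }
  refine ⟨H \ M, sdiff_le, fun v => ?_⟩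
  obtain ⟨w, hw, hadj⟩ : ∃ w, (∀ x, M.Adj v x ↔ x = w) ∧ H.Adj v w := by
    cases hv : c v with
    | false =>
      refine ⟨f v, fun x => ⟨?_, fun h => Or.inl ⟨hv, h.symm⟩⟩, hf v⟩
      rintro (h | ⟨hx, rfl⟩)
      · exact h.2.symm
      · exact absurd (hx.trans hv.symm) (hc _ _ (hf x))
    | true =>
      have hadj : H.Adj (f.symm v) v := by simpa using hf (f.symm v)
      refine ⟨f.symm v, fun x => ⟨?_, ?_⟩, hadj.symm⟩
      · rintro (h | ⟨-, rfl⟩)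
        · simp [hv] at h
        · simp
      · rintro rfl
        refine Or.inr ⟨?_, by simp⟩
        simpa [hv] using hc _ _ hadj
  have hset : (H \ M).neighborSet v = H.neighborSet v \ {w} := by
    ext x
    simp [hw]
  rw [hset, Set.ncard_sdiff_singleton_of_mem ((H.mem_neighborSet v w).mpr hadj), hreg v,
    Nat.add_sub_cancel]

/-- every `k`-regular bipartite graph has an `r`-regular spanning
subgraph for every `0 ≤ r ≤ k`. -/
theorem stmt4 {V : Type*} [Fintype V] (H : SimpleGraph V) (k : ℕ)
    (hreg : ∀ v : V, (H.neighborSet v).ncard = k)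
    (hbip : ∃ c : V → Bool, ∀ u v : V, H.Adj u v → c u ≠ c v)
    (r : ℕ) (hr : r ≤ k) :
    ∃ G : SimpleGraph V, G ≤ H ∧ ∀ v : V, (G.neighborSet v).ncard = r := by
  obtain ⟨c, hc⟩ := hbip
  induction k generalizing H with
  | zero => exact ⟨H, le_rfl, fun v => (hreg v).trans (Nat.le_zero.mp hr).symm⟩
  | succ k ih =>
    rcases hr.eq_or_lt with rfl | hlt
    · exact ⟨H, le_rfl, hreg⟩
    · obtain ⟨H', hle, hreg'⟩ := H.exists_le_ncard_neighborSet_eq_of_succ hreg c hc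
      obtain ⟨G, hG, hGreg⟩ := ih H' hreg' (Nat.lt_succ_iff.mp hlt)
        fun u v h => hc u v (hle h)
      exact ⟨G, hG.trans hle, hGreg⟩
end
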